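/- Let X ⊂ P^r be an integral non-degenerate projective variety of dimension n. Then the variety G_k(X) of (k+1)-secant k-planes has dimension equal to min{n(k+1), (r-k)(k+1)}, the expected dimension. -/

import Mathlib

open Submodule

noncomputable section

/-- Polynomial functions on a complex module: the subalgebra of functions generated by
the linear functionals. -/
def PolyFun (W : Type*) [AddCommGroup W] [Module ℂ W] : Subalgebra ℂ (W → ℂ) :=
  Algebra.adjoin ℂ {f : W → ℂ | IsLinearMap ℂ f}

/-- A subset of a complex module is algebraic (Zariski closed) if it is the common zero
set of a family of polynomial functions. -/
def IsAlgSet {W : Type*} [AddCommGroup W] [Module ℂ W] (X : Set W) : Prop :=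
  ∃ S : Set (W → ℂ), S ⊆ (PolyFun W : Set (W → ℂ)) ∧ X = {x | ∀ f ∈ S, f x = 0}

/-- Zariski closure. -/
def zcl {W : Type*} [AddCommGroup W] [Module ℂ W] (A : Set W) : Set W :=
  ⋂₀ {Y | IsAlgSet Y ∧ A ⊆ Y}

/-- Irreducible algebraic set. -/
def IsIrrAlg {W : Type*} [AddCommGroup W] [Module ℂ W] (X : Set W) : Prop :=
  X.Nonempty ∧ IsAlgSet X ∧
    ∀ Y Z : Set W, IsAlgSet Y → IsAlgSet Z → X ⊆ Y ∪ Z → X ⊆ Y ∨ X ⊆ Z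

/-- Dimension of an (affine) algebraic set: the supremum of the lengths of strict chains
of irreducible algebraic subsets contained in it. -/
def adim {W : Type*} [AddCommGroup W] [Module ℂ W] (X : Set W) : ℕ∞ :=
  sSup {d : ℕ∞ | ∃ n : ℕ, d = (n : ℕ∞) ∧
    ∃ c : Fin (n + 1) → Set W, StrictMono c ∧ ∀ i, IsIrrAlg (c i) ∧ c i ⊆ X}

/-- Projective dimension of a cone: one less than the dimension of the affine cone. -/
def pdim {W : Type*} [AddCommGroup W] [Module ℂ W] (X : Set W) : ℕ∞ := adim X - 1

/-- A cone in a complex module (the affine cone of a projective set). -/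
def IsCone {W : Type*} [AddCommGroup W] [Module ℂ W] (X : Set W) : Prop :=
  (0 : W) ∈ X ∧ ∀ (c : ℂ) (x : W), x ∈ X → c • x ∈ X

/-- The affine cone of an integral projective variety: an irreducible algebraic cone,
different from the origin alone. -/
def IsProjVar {W : Type*} [AddCommGroup W] [Module ℂ W] (X : Set W) : Prop :=
  IsAlgSet X ∧ IsCone X ∧ IsIrrAlg X ∧ X ≠ {0}

/-- Non-degenerate: the cone spans the ambient space. -/
def Nondeg {W : Type*} [AddCommGroup W] [Module ℂ W] (X : Set W) : Prop :=
  Submodule.span ℂ X = ⊤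

/-- The projective set is a cone over some vertex: there is a point `v` (vertex) of the
variety such that the variety is a union of lines through the vertex. -/
def IsConeVar {W : Type*} [AddCommGroup W] [Module ℂ W] (X : Set W) : Prop :=
  ∃ v ∈ X, v ≠ 0 ∧ ∀ x ∈ X, ∀ a b : ℂ, a • v + b • x ∈ X

/-- Affine cone of the `k`-th secant variety `S_k(X)`: the Zariski closure of the union
of the linear spans of `k+1` points of `X`. -/
def Sec {W : Type*} [AddCommGroup W] [Module ℂ W] (X : Set W) (k : ℕ) : Set W :=
  zcl (⋃ p ∈ {p : Fin (k + 1) → W | ∀ i, p i ∈ X},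
    (Submodule.span ℂ (Set.range p) : Set W))

/-- Plücker points of the spans of `(k+1)`-tuples of points of `X`: the raw affine cone
over the image of the span map `Φ : X^{k+1} ⇢ G(k,r)` in Plücker coordinates. -/
def GkConePre {W : Type*} [AddCommGroup W] [Module ℂ W] (X : Set W) (k : ℕ) :
    Set (ExteriorAlgebra ℂ W) :=
  {w | ∃ p : Fin (k + 1) → W, (∀ i, p i ∈ X) ∧ w = ExteriorAlgebra.ιMulti ℂ (k + 1) p}

/-- Affine cone over `G_k(X)` (in Plücker coordinates): Zariski closure of the cone over
the image of the span map. -/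
def GkCone {W : Type*} [AddCommGroup W] [Module ℂ W] (X : Set W) (k : ℕ) :
    Set (ExteriorAlgebra ℂ W) :=
  zcl (GkConePre X k)

/-- `G_k(X)` as a set of `(k+1)`-dimensional subspaces (projective `k`-planes): those
whose Plücker point lies in the closure of the image of the span map. -/
def Gk {W : Type*} [AddCommGroup W] [Module ℂ W] (X : Set W) (k : ℕ) :
    Set (Submodule ℂ W) :=
  {U | Module.finrank ℂ U = k + 1 ∧
    ∀ p : Fin (k + 1) → W, (∀ i, p i ∈ U) →
      ExteriorAlgebra.ιMulti ℂ (k + 1) p ∈ GkCone X k}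

/-- Raw cone of Plücker points of `h`-planes contained in some `(k+1)`-secant `k`-plane. -/
def GhkConePre {W : Type*} [AddCommGroup W] [Module ℂ W] (X : Set W) (h k : ℕ) :
    Set (ExteriorAlgebra ℂ W) :=
  {w | ∃ (p : Fin (k + 1) → W) (q : Fin (h + 1) → W), (∀ i, p i ∈ X) ∧
    (∀ j, q j ∈ Submodule.span ℂ (Set.range p)) ∧
    w = ExteriorAlgebra.ιMulti ℂ (h + 1) q}

/-- Affine cone over `G_{h,k}(X)` in Plücker coordinates. -/
def GhkCone {W : Type*} [AddCommGroup W] [Module ℂ W] (X : Set W) (h k : ℕ) :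
    Set (ExteriorAlgebra ℂ W) :=
  zcl (GhkConePre X h k)

theorem exists_trdeg_eq_and_ringKrullDim_eq (k A : Type*) [Field k] [CommRing A] [IsDomain A]
    [Algebra k A] [Algebra.FiniteType k A] :
    ∃ s : ℕ, Algebra.trdeg k A = s ∧ ringKrullDim A = s := by
  obtain ⟨s, g, hg, h_integral⟩ := exists_integral_inj_algHom_of_fg k A
  refine ⟨s, ?_, ?_⟩
  · algebraize [g.toRingHom]
    have : IsScalarTower k (MvPolynomial (Fin s) k) A :=
      .of_algebraMap_eq fun x => (g.commutes x).symm
    have : Algebra.IsIntegral (MvPolynomial (Fin s) k) A := ⟨h_integral⟩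
    have : FaithfulSMul (MvPolynomial (Fin s) k) A :=
      (faithfulSMul_iff_algebraMap_injective _ _).mpr hg
    have h := (IsTranscendenceBasis.mvPolynomial (Fin s) k).algebraMap_comp (A := A)
    simpa using h.lift_cardinalMk_eq_trdeg.symm
  · algebraize [g.toRingHom]
    have : Algebra.IsIntegral (MvPolynomial (Fin s) k) A := ⟨h_integral⟩
    have hs : ringKrullDim (MvPolynomial (Fin s) k) = s := by
      simp [MvPolynomial.ringKrullDim_of_isNoetherianRing]
    apply le_antisymm
    · rw [← hs]
      refine Order.krullDim_le_of_strictMono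
        (PrimeSpectrum.comap (algebraMap (MvPolynomial (Fin s) k) A)) fun I J hIJ => ?_
      exact Ideal.IsIntegral.comap_lt_comap (R := MvPolynomial (Fin s) k) hIJ
    · rw [← hs]
      refine iSup_le fun l => ?_
      obtain ⟨Q, -, hQ, hQl⟩ := Ideal.exists_ideal_over_prime_of_isIntegral_of_isPrime
        (S := A) l.head.asIdeal ⊥ (by
          exact (Ideal.comap_bot_of_injective (algebraMap _ A) hg).le.trans bot_le)
      have : Algebra.HasGoingUp (MvPolynomial (Fin s) k) A := by
        refine ⟨fun {q} _ P _ h => ?_⟩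
        obtain ⟨Q, h1, h2, h3⟩ := Ideal.exists_ideal_over_prime_of_isIntegral_of_isPrime q P h.le
        exact ⟨Q, h1, h2, ⟨h3.symm⟩⟩
      have : Q.LiesOver (RelSeries.head l).asIdeal := ⟨hQl.symm⟩
      obtain ⟨L, hL, -⟩ := Ideal.exists_ltSeries_of_hasGoingUp (S := A) l Q
      rw [← hL]
      exact le_iSup (fun p : LTSeries (PrimeSpectrum A) => (p.length : WithBot ℕ∞)) L

/-- Pullback of functions along a map. -/
def pullback {T W : Type*} (φ : T → W) : (W → ℂ) →ₐ[ℂ] (T → ℂ) :=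
  AlgHom.pi fun t => Pi.evalAlgHom ℂ _ (φ t)

@[simp]
theorem pullback_apply {T W : Type*} (φ : T → W) (f : W → ℂ) (t : T) :
    pullback φ f t = f (φ t) := rfl

/-- The algebra of pullbacks along `φ` of polynomial functions. -/
def coordAlg {T W : Type*} [AddCommGroup W] [Module ℂ W] (φ : T → W) : Subalgebra ℂ (T → ℂ) :=
  (PolyFun W).map (pullback φ)

section Coordinates

variable {W : Type*} [AddCommGroup W] [Module ℂ W] {N : ℕ} (b : Module.Basis (Fin N) ℂ W)

/-- The polynomial function attached to a polynomial in the coordinates of a basis. -/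
def polyEval : MvPolynomial (Fin N) ℂ →ₐ[ℂ] (W → ℂ) :=
  MvPolynomial.aeval fun i w => b.repr w i

theorem polyEval_apply (P : MvPolynomial (Fin N) ℂ) (w : W) :
    polyEval b P w = MvPolynomial.aeval (b.equivFun w) P := by
  change (Pi.evalAlgHom ℂ (fun _ : W => ℂ) w).comp (polyEval b) P = _
  congr 1
  ext i
  simp [polyEval]

theorem range_polyEval : (polyEval b).range = PolyFun W := by
  rw [polyEval, ← Algebra.adjoin_range_eq_range_aeval]
  apply le_antisymm
  · refine Algebra.adjoin_mono ?_
    rintro _ ⟨i, rfl⟩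
    exact (b.coord i).isLinear
  · refine Algebra.adjoin_le ?_
    intro f (hf : IsLinearMap ℂ f)
    have : f = ∑ i, f (b i) • fun w => b.repr w i := by
      ext w
      conv_lhs => rw [← b.sum_repr w]
      have := map_sum hf.mk' (fun i => b.repr w i • b i) Finset.univ
      simp only [map_smul, IsLinearMap.mk'_apply] at this
      rw [this]
      simp [mul_comm]
    rw [this]
    exact sum_mem fun i _ => Subalgebra.smul_mem _ (Algebra.subset_adjoin (Set.mem_range_self i)) _

/-- Ideal of polynomials vanishing on a set. -/
def vanIdeal (Z : Set W) : Ideal (MvPolynomial (Fin N) ℂ) :=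
  MvPolynomial.vanishingIdeal ℂ (b.equivFun '' Z)

/-- Common zeros of an ideal. -/
def zeroSet (I : Ideal (MvPolynomial (Fin N) ℂ)) : Set W :=
  b.equivFun ⁻¹' MvPolynomial.zeroLocus ℂ I

variable {b}

theorem mem_vanIdeal {Z : Set W} {P : MvPolynomial (Fin N) ℂ} :
    P ∈ vanIdeal b Z ↔ ∀ w ∈ Z, polyEval b P w = 0 := by
  simp only [vanIdeal, MvPolynomial.mem_vanishingIdeal_iff, Set.forall_mem_image, polyEval_apply]

theorem mem_zeroSet {I : Ideal (MvPolynomial (Fin N) ℂ)} {w : W} :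
    w ∈ zeroSet b I ↔ ∀ P ∈ I, polyEval b P w = 0 := by
  simp only [zeroSet, Set.mem_preimage, MvPolynomial.mem_zeroLocus_iff, polyEval_apply]

theorem isAlgSet_zeroSet (I : Ideal (MvPolynomial (Fin N) ℂ)) : IsAlgSet (zeroSet b I) := by
  refine ⟨polyEval b '' I, ?_, ?_⟩
  · rw [← range_polyEval b]
    rintro _ ⟨P, -, rfl⟩
    exact ⟨P, rfl⟩
  · ext w
    simp [mem_zeroSet]

theorem zeroSet_vanIdeal {Z : Set W} (hZ : IsAlgSet Z) : zeroSet b (vanIdeal b Z) = Z := by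
  obtain ⟨S, hS, rfl⟩ := hZ
  apply Set.Subset.antisymm
  · intro w hw f hf
    obtain ⟨P, rfl⟩ : f ∈ (polyEval b).range := by rw [range_polyEval]; exact hS hf
    exact mem_zeroSet.1 hw P (mem_vanIdeal.2 fun w hw => hw _ hf)
  · intro w hw
    exact mem_zeroSet.2 fun P hP => mem_vanIdeal.1 hP w hw

theorem vanIdeal_anti {Y Z : Set W} (h : Y ⊆ Z) : vanIdeal b Z ≤ vanIdeal b Y :=
  fun _ hP => mem_vanIdeal.2 fun w hw => mem_vanIdeal.1 hP w (h hw)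

theorem zeroSet_anti {I J : Ideal (MvPolynomial (Fin N) ℂ)} (h : I ≤ J) :
    zeroSet b J ⊆ zeroSet b I :=
  fun _ hw => mem_zeroSet.2 fun P hP => mem_zeroSet.1 hw P (h hP)

theorem vanIdeal_zeroSet (P : Ideal (MvPolynomial (Fin N) ℂ)) [P.IsPrime] :
    vanIdeal b (zeroSet b P) = P := by
  rw [vanIdeal, zeroSet, Set.image_preimage_eq _ b.equivFun.surjective]
  exact MvPolynomial.IsPrime.vanishingIdeal_zeroLocus P

theorem isPrime_vanIdeal {Z : Set W} (hZ : IsIrrAlg Z) : (vanIdeal b Z).IsPrime := by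
  obtain ⟨⟨w, hw⟩, hZa, hZi⟩ := hZ
  refine ⟨fun h => ?_, fun {P Q} hPQ => ?_⟩
  · have := mem_vanIdeal.1 ((Ideal.eq_top_iff_one _).1 h) w hw
    simp at this
  · have key : ∀ P : MvPolynomial (Fin N) ℂ, Z ⊆ zeroSet b (Ideal.span {P}) →
        P ∈ vanIdeal b Z := fun P h => mem_vanIdeal.2 fun w hw =>
      mem_zeroSet.1 (h hw) P (Ideal.mem_span_singleton_self P)
    refine (hZi _ _ (isAlgSet_zeroSet (b := b) (Ideal.span {P}))
      (isAlgSet_zeroSet (b := b) (Ideal.span {Q})) fun w hw => ?_).imp (key P) (key Q)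
    have := mem_vanIdeal.1 hPQ w hw
    rw [map_mul, Pi.mul_apply, mul_eq_zero] at this
    refine this.imp (fun h => ?_) (fun h => ?_) <;>
    · refine mem_zeroSet.2 fun R hR => ?_
      obtain ⟨R, rfl⟩ := Ideal.mem_span_singleton.1 hR
      simp [h]

theorem isIrrAlg_zeroSet (P : Ideal (MvPolynomial (Fin N) ℂ)) [hP : P.IsPrime] :
    IsIrrAlg (zeroSet b P) := by
  refine ⟨?_, isAlgSet_zeroSet P, fun Y Z hY hZ h => ?_⟩
  · rw [Set.nonempty_iff_ne_empty]
    intro h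
    have h1 := vanIdeal_zeroSet (b := b) P
    refine hP.ne_top ?_
    rw [← h1, Ideal.eq_top_iff_one, mem_vanIdeal, h]
    simp
  · have : vanIdeal b Y * vanIdeal b Z ≤ P := by
      rw [Ideal.mul_le]
      intro f hf g hg
      rw [← vanIdeal_zeroSet (b := b) P, mem_vanIdeal]
      intro w hw
      rw [map_mul, Pi.mul_apply]
      rcases h hw with h | h
      · rw [mem_vanIdeal.1 hf w h, zero_mul]
      · rw [mem_vanIdeal.1 hg w h, mul_zero]
    rw [← zeroSet_vanIdeal (b := b) hY, ← zeroSet_vanIdeal (b := b) hZ]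
    exact (hP.mul_le.1 this).imp zeroSet_anti zeroSet_anti

theorem isAlgSet_zcl (A : Set W) : IsAlgSet (zcl A) := by
  choose! S hS hS' using fun (Y : Set W) (h : IsAlgSet Y) => h
  refine ⟨⋃ Y ∈ {Y | IsAlgSet Y ∧ A ⊆ Y}, S Y, ?_, ?_⟩
  · simp only [Set.iUnion_subset_iff]
    exact fun Y hY => hS Y hY.1
  · ext w
    simp only [zcl, Set.mem_sInter, Set.mem_ofPred_eq, Set.mem_iUnion]
    constructor
    · rintro h f ⟨Y, hY, hf⟩
      have := h Y hY
      rw [hS' Y hY.1] at this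
      exact this f hf
    · intro h Y hY
      rw [hS' Y hY.1]
      exact fun f hf => h f ⟨Y, hY, hf⟩

theorem subset_zcl (A : Set W) : A ⊆ zcl A := Set.subset_sInter fun _ h => h.2

theorem zcl_subset {A Y : Set W} (hY : IsAlgSet Y) (h : A ⊆ Y) : zcl A ⊆ Y :=
  Set.sInter_subset_of_mem ⟨hY, h⟩

theorem vanIdeal_zcl (A : Set W) : vanIdeal b (zcl A) = vanIdeal b A := by
  refine le_antisymm (vanIdeal_anti (subset_zcl A)) fun P hP => mem_vanIdeal.2 fun w hw => ?_
  have : zcl A ⊆ zeroSet b (vanIdeal b A) := zcl_subset (isAlgSet_zeroSet _) fun w hw =>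
    mem_zeroSet.2 fun P hP => mem_vanIdeal.1 hP w hw
  exact mem_zeroSet.1 (this hw) P hP

variable (b) in
/-- Irreducible algebraic subsets of the closure of `A` correspond to primes containing the
ideal of `A`. -/
def irrAlgOrderIso (A : Set W) : {Z : Set W // IsIrrAlg Z ∧ Z ⊆ zcl A} ≃o
    (PrimeSpectrum.zeroLocus (vanIdeal b A : Set (MvPolynomial (Fin N) ℂ)))ᵒᵈ where
  toFun Z := OrderDual.toDual ⟨⟨vanIdeal b Z.1, isPrime_vanIdeal Z.2.1⟩, by
    rw [PrimeSpectrum.mem_zeroLocus, SetLike.coe_subset_coe, ← vanIdeal_zcl]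
    exact vanIdeal_anti Z.2.2⟩
  invFun Q := ⟨zeroSet b (OrderDual.ofDual Q).1.asIdeal, isIrrAlg_zeroSet _, by
    rw [← zeroSet_vanIdeal (b := b) (isAlgSet_zcl A), vanIdeal_zcl]
    exact zeroSet_anti (OrderDual.ofDual Q).2⟩
  left_inv Z := Subtype.ext (zeroSet_vanIdeal Z.2.1.2.1)
  right_inv Q := by
    apply Subtype.ext
    apply PrimeSpectrum.ext
    exact vanIdeal_zeroSet _
  map_rel_iff' {Y Z} := by
    constructor
    · intro h
      change Y.1 ⊆ Z.1
      rw [← zeroSet_vanIdeal (b := b) Y.2.1.2.1, ← zeroSet_vanIdeal (b := b) Z.2.1.2.1]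
      exact zeroSet_anti h
    · intro h
      exact vanIdeal_anti h

end Coordinates

theorem adim_eq_of_krullDim_eq {W : Type*} [AddCommGroup W] [Module ℂ W] {X : Set W} {s : ℕ}
    (h : Order.krullDim {Z : Set W // IsIrrAlg Z ∧ Z ⊆ X} = s) : adim X = s := by
  apply le_antisymm
  · refine sSup_le ?_
    rintro _ ⟨n, rfl, c, hc, hcX⟩
    let l : LTSeries {Z : Set W // IsIrrAlg Z ∧ Z ⊆ X} :=
      ⟨n, fun i => ⟨c i, hcX i⟩, fun i => hc (Fin.castSucc_lt_succ)⟩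
    have := Order.LTSeries.length_le_krullDim l
    rw [h] at this
    exact_mod_cast this
  · obtain ⟨l, hl⟩ := Order.le_krullDim_iff.1 h.ge
    refine le_sSup ⟨s, rfl, ?_⟩
    subst hl
    exact ⟨fun i => (l i).1, fun i j hij => l.strictMono hij, fun i => (l i).2⟩

theorem adim_zcl_range {T W : Type*} [AddCommGroup W] [Module ℂ W] [Module.Finite ℂ W]
    (φ : T → W) [IsDomain (coordAlg φ)] :
    ∃ s : ℕ, Algebra.trdeg ℂ (coordAlg φ) = s ∧ adim (zcl (Set.range φ)) = s := by
  let b := Module.finBasis ℂ W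
  let f : MvPolynomial (Fin (Module.finrank ℂ W)) ℂ →ₐ[ℂ] coordAlg φ :=
    ((pullback φ).comp (polyEval b)).codRestrict (coordAlg φ) fun P => by
      rw [coordAlg, ← range_polyEval b]
      exact ⟨polyEval b P, ⟨P, rfl⟩, rfl⟩
  have hf : Function.Surjective f := by
    rintro ⟨_, h, hh, rfl⟩
    obtain ⟨P, rfl⟩ : h ∈ (polyEval b).range := by rw [range_polyEval]; exact hh
    exact ⟨P, rfl⟩
  have hker : RingHom.ker f = vanIdeal b (Set.range φ) := by
    ext P
    rw [mem_vanIdeal, RingHom.mem_ker, Set.forall_mem_range, Subtype.ext_iff, funext_iff]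
    rfl
  have := Algebra.FiniteType.of_surjective f hf
  obtain ⟨s, hs, hs'⟩ := exists_trdeg_eq_and_ringKrullDim_eq ℂ (coordAlg φ)
  refine ⟨s, hs, adim_eq_of_krullDim_eq ?_⟩
  rw [Order.krullDim_eq_of_orderIso (irrAlgOrderIso b (Set.range φ)), Order.krullDim_orderDual,
    ← ringKrullDim_quotient, ← hker, ← hs']
  exact ringKrullDim_eq_of_ringEquiv (Ideal.quotientKerAlgEquivOfSurjective hf).toRingEquiv

theorem KaehlerDifferential.exists_basis_of_isTranscendenceBasis {L F ι : Type} [Field L]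
    [Field F] [Algebra L F] [CharZero L] {u : ι → F} (hu : IsTranscendenceBasis L u) :
    ∃ b : Module.Basis ι F (Ω[F⁄L]), ∀ i, b i = KaehlerDifferential.D L F (u i) := by
  let f : MvPolynomial ι L →ₐ[L] F := MvPolynomial.aeval u
  have hf : Function.Injective f := hu.1
  algebraize [f.toRingHom]
  have : IsScalarTower L (MvPolynomial ι L) F :=
    .of_algebraMap_eq fun x => (f.commutes x).symm
  have : FaithfulSMul (MvPolynomial ι L) F := (faithfulSMul_iff_algebraMap_injective _ _).mpr hf
  have halg : Algebra.IsAlgebraic (MvPolynomial ι L) F := by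
    have := hu.isAlgebraic
    refine (Algebra.isAlgebraic_ringHom_iff_of_comp_eq hu.1.aevalEquiv (RingEquiv.refl F) ?_).1 this
    ext x
    · simp [f, RingHom.algebraMap_toAlgebra]
    · simp [f, RingHom.algebraMap_toAlgebra]
  let := FractionRing.liftAlgebra (MvPolynomial ι L) F
  have : IsScalarTower (MvPolynomial ι L) (FractionRing (MvPolynomial ι L)) F :=
    FractionRing.isScalarTower_liftAlgebra _ _
  have : Algebra.IsAlgebraic (FractionRing (MvPolynomial ι L)) F :=
    Algebra.IsAlgebraic.extendScalars (R := MvPolynomial ι L) (IsFractionRing.injective _ _)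
  have : CharZero (FractionRing (MvPolynomial ι L)) :=
    charZero_of_injective_algebraMap (R := L) (algebraMap L _).injective
  have := Algebra.FormallyEtale.of_isSeparable (FractionRing (MvPolynomial ι L)) F
  have := Algebra.FormallyEtale.of_isLocalization (R := MvPolynomial ι L)
    (Rₘ := FractionRing (MvPolynomial ι L)) (nonZeroDivisors (MvPolynomial ι L))
  have : Algebra.FormallyEtale (MvPolynomial ι L) F :=
    .comp _ (FractionRing (MvPolynomial ι L)) _
  have hbc := KaehlerDifferential.isBaseChange_of_formallyEtale L (MvPolynomial ι L) F
  refine ⟨hbc.basis (KaehlerDifferential.mvPolynomialBasis L ι), fun i => ?_⟩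
  rw [IsBaseChange.basis_apply]
  have : KaehlerDifferential.mvPolynomialBasis L ι i =
      KaehlerDifferential.D L (MvPolynomial ι L) (MvPolynomial.X i) := by
    rw [← Module.Basis.repr_symm_single_one,
      KaehlerDifferential.mvPolynomialBasis_repr_symm_single, one_smul]
  rw [this, KaehlerDifferential.map_D]
  simp [f, RingHom.algebraMap_toAlgebra]

/-- The elements of a field killed by a derivation. -/
def Derivation.constants {K F : Type*} [Field K] [Field F] [Algebra K F]
    (D : Derivation K F F) : IntermediateField K F where
  carrier := {x | D x = 0}
  mul_mem' {a b} ha hb := by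
    change D (a * b) = 0
    rw [D.leibniz, show D a = 0 from ha, show D b = 0 from hb]; simp
  add_mem' {a b} ha hb := by
    change D (a + b) = 0
    rw [map_add, show D a = 0 from ha, show D b = 0 from hb, add_zero]
  algebraMap_mem' := D.map_algebraMap
  inv_mem' a ha := by
    change D a⁻¹ = 0
    rw [D.leibniz_inv, show D a = 0 from ha, smul_zero]

theorem Derivation.mem_constants {K F : Type*} [Field K] [Field F] [Algebra K F]
    {D : Derivation K F F} {x : F} : x ∈ D.constants ↔ D x = 0 := Iff.rfl

theorem Derivation.eq_zero_of_isAlgebraic_constants {K F : Type*} [Field K] [Field F] [Algebra K F]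
    [CharZero K] (D : Derivation K F F) {x : F} (hx : IsAlgebraic D.constants x) : D x = 0 := by
  let D' : Derivation D.constants F F := Derivation.mk'
    { toFun := D
      map_add' := map_add D
      map_smul' := fun c y => by
        rw [Algebra.smul_def, D.leibniz, show D (algebraMap _ F c) = 0 from c.2]
        simp [Algebra.smul_def] } D.leibniz
  have : CharZero D.constants :=
    charZero_of_injective_algebraMap (R := K) (algebraMap K _).injective
  have hsep := (minpoly.irreducible hx.isIntegral).separable
  have h0 := D'.map_aeval (minpoly D.constants x) x
  rw [minpoly.aeval, map_zero, eq_comm, smul_eq_mul, mul_eq_zero] at h0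
  exact h0.resolve_left (hsep.aeval_derivative_ne_zero (minpoly.aeval _ _))

section Matroid

open AlgebraicIndependent

variable {K F : Type} [Field K] [Field F] [Algebra K F]

theorem Derivation.eq_zero_of_mem_closure [CharZero K] (D : Derivation K F F) {S : Set F}
    (hS : ∀ x ∈ S, D x = 0) {x : F} (hx : x ∈ (matroid K F).closure S) : D x = 0 := by
  rw [matroid_closure_eq] at hx
  refine D.eq_zero_of_isAlgebraic_constants ?_
  have : IsAlgebraic (Algebra.adjoin K S) x := hx
  exact this.tower_top_of_subalgebra_le (B := D.constants.toSubalgebra)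
    (Algebra.adjoin_le fun y hy => hS y hy)

theorem exists_linearIndependent_derivation [CharZero K] {S : Set F} {a b : ℕ}
    (ha : a ≤ (matroid K F).eRk Set.univ) (hb : (matroid K F).eRk S ≤ b) :
    ∃ D : Fin (a - b) → Derivation K F F, LinearIndependent F D ∧ ∀ i, ∀ x ∈ S, D i x = 0 := by
  obtain ⟨I, hI⟩ := (matroid K F).exists_isBasis S
  obtain ⟨J, hJ, hIJ⟩ := hI.indep.exists_isBase_superset
  have hJa : a ≤ J.encard := by
    rwa [Matroid.eRk_univ_eq, ← hJ.encard_eq_eRank] at ha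
  have hIb : I.encard ≤ b := by rwa [hI.encard_eq_eRk]
  have hab : ((a - b : ℕ) : ℕ∞) ≤ (J \ I).encard := by
    rw [ENat.natCast_sub, tsub_le_iff_right]
    calc (a : ℕ∞) ≤ J.encard := hJa
      _ = (J \ I).encard + I.encard := (Set.encard_sdiff_add_encard_of_subset hIJ).symm
      _ ≤ (J \ I).encard + b := by gcongr
  obtain ⟨t, ht, htc⟩ := Set.exists_subset_encard_eq hab
  have htf : t.Finite := Set.finite_of_encard_eq_coe htc
  have : Fintype t := htf.fintype
  have hcard : Fintype.card t = a - b := by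
    rw [← Nat.card_eq_fintype_card, Nat.card_coe_set_eq, Set.ncard, htc, ENat.toNat_natCast]
  let e : Fin (a - b) ≃ t := (Fintype.equivFinOfCardEq hcard).symm
  obtain ⟨β, hβ⟩ := KaehlerDifferential.exists_basis_of_isTranscendenceBasis
    (matroid_isBase_iff.1 hJ)
  let e' : Fin (a - b) → J := fun i => ⟨e i, (ht (e i).2).1⟩
  have he' : Function.Injective e' := fun i j h =>
    e.injective (Subtype.ext (congrArg (fun y : J => (y : F)) h))
  let D : Fin (a - b) → Derivation K F F := fun i =>
    (β.coord (e' i)).compDer (KaehlerDifferential.D K F)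
  classical
  have hD : ∀ i (j : J), D i j = if j = e' i then 1 else 0 := by
    intro i j
    change β.repr (KaehlerDifferential.D K F j) (e' i) = _
    rw [← hβ j, Module.Basis.repr_self, Finsupp.single_apply]
  refine ⟨D, ?_, fun i x hx => ?_⟩
  · rw [Fintype.linearIndependent_iff]
    intro g hg i
    have := congrArg (fun d : Derivation K F F => Derivation.coeFnAddMonoidHom d (e' i)) hg
    simp only [map_sum, Finset.sum_apply] at this
    simpa [hD, he'.eq_iff] using this
  · refine (D i).eq_zero_of_mem_closure (S := I) (fun y hy => ?_) (hI.subset_closure hx)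
    rw [hD i ⟨y, hIJ hy⟩, if_neg]
    intro h
    exact (ht (e i).2).2 (congrArg (fun y : J => (y : F)) h ▸ hy)

theorem exists_derivation_mem_span [CharZero K] {ι : Type} (x : ι → F) {n : ℕ}
    (hn : (matroid K F).eRk (Set.range x) ≤ n) :
    ∃ (t : Set (ι → F)), t.encard ≤ n ∧
      (∀ v ∈ t, ∀ j, v j ∈ IntermediateField.adjoin K (Set.range x)) ∧
      ∀ D : Derivation K F F, (fun j => D (x j)) ∈ Submodule.span F t := by
  let E := IntermediateField.adjoin K (Set.range x)
  let s : Set E := Subtype.val ⁻¹' Set.range x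
  have hx : ∀ j, x j ∈ E := fun j => IntermediateField.subset_adjoin _ _ (Set.mem_range_self j)
  have hmem : ∀ y ∈ Algebra.adjoin K (Set.range x), ∃ z ∈ Algebra.adjoin K s, (z : F) = y := by
    intro y hy
    have : Set.range x = E.val '' s := by
      refine (Set.image_preimage_eq_of_subset ?_).symm
      rintro _ ⟨j, rfl⟩
      exact ⟨⟨x j, hx j⟩, rfl⟩
    rw [this, ← AlgHom.map_adjoin] at hy
    exact hy
  have : Algebra.IsAlgebraic (Algebra.adjoin K s) E := by
    refine ⟨fun z => ?_⟩
    obtain ⟨y, hy, w, hw, hz⟩ := IntermediateField.mem_adjoin_iff_div.1 z.2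
    obtain ⟨y, hy', rfl⟩ := hmem y hy
    obtain ⟨w, hw', rfl⟩ := hmem w hw
    have : z = y * w⁻¹ := Subtype.ext (by simp [hz, div_eq_mul_inv])
    rw [this]
    exact (isAlgebraic_algebraMap (⟨y, hy'⟩ : Algebra.adjoin K s)).mul
      (isAlgebraic_algebraMap (⟨w, hw'⟩ : Algebra.adjoin K s)).inv
  obtain ⟨u, hus, hu⟩ := exists_isTranscendenceBasis_subset (R := K) s
  have hu' : AlgebraicIndepOn K id (E.val '' u) := by
    have := (hu.1.map' (f := E.val) E.val.injective)
    exact AlgebraicIndependent.image (f := E.val) this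
  have hun : u.encard ≤ n := by
    rw [← E.val.injective.encard_image]
    refine (Matroid.Indep.encard_le_eRk_of_subset (matroid_indep_iff.2 hu') ?_).trans hn
    rintro _ ⟨y, hy, rfl⟩
    exact hus hy
  obtain ⟨β, hβ⟩ := KaehlerDifferential.exists_basis_of_isTranscendenceBasis hu
  let τ : u → ι → F := fun a j => β.repr (KaehlerDifferential.D K E ⟨x j, hx j⟩) a
  refine ⟨Set.range τ, ?_, ?_, fun D => ?_⟩
  · rw [← Set.image_univ]
    refine (Set.encard_image_le _ _).trans ?_
    rwa [Set.encard_univ]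
  · rintro _ ⟨a, rfl⟩ j
    exact (β.repr (KaehlerDifferential.D K E ⟨x j, hx j⟩) a).2
  · have hufin : u.Finite := Set.finite_of_encard_le_coe hun
    have : Fintype u := hufin.fintype
    have : (fun j => D (x j)) = ∑ a : u, D ((a : E) : F) • τ a := by
      ext j
      have h1 := (D.compAlgebraMap E).liftKaehlerDifferential_comp_D ⟨x j, hx j⟩
      rw [← β.sum_repr (KaehlerDifferential.D K E ⟨x j, hx j⟩), map_sum] at h1
      simp only [map_smul, hβ, Derivation.liftKaehlerDifferential_comp_D] at h1
      rw [Finset.sum_apply]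
      refine h1.symm.trans (Finset.sum_congr rfl fun a _ => ?_)
      rw [Pi.smul_apply, smul_eq_mul, mul_comm]
      rfl
    rw [this]
    exact sum_mem fun a _ => smul_mem _ _ (subset_span (Set.mem_range_self a))

end Matroid

theorem notMem_span_of_linearIndependent {E F ι : Type*} [Field E] [Field F] [Algebra E F]
    [Finite ι] {S : Set (ι → F)} (hS : ∀ v ∈ S, ∀ j, v j ∈ (algebraMap E F).range)
    (hS' : span F S ≠ ⊤) {p : ι → F} (hp : LinearIndependent E p) : p ∉ span F S := by
  classical
  cases nonempty_fintype ι
  let a : (ι → E) →ₗ[E] (ι → F) := (Algebra.linearMap E F).compLeft ι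
  have ha : ∀ (w : ι → E) j, a w j = algebraMap E F (w j) := fun _ _ => rfl
  let S' : Set (ι → E) := a ⁻¹' S
  have hne : span E S' ≠ ⊤ := by
    intro h
    apply hS'
    rw [eq_top_iff]
    rintro v -
    rw [← Finset.univ_sum_single v]
    refine sum_mem fun j _ => ?_
    have h1 : (Pi.single j 1 : ι → E) ∈ span E S' := h ▸ mem_top
    have h2 : a (Pi.single j 1) ∈ span F S := by
      have h3 : span E S' ≤ ((span F S).restrictScalars E).comap a :=
        span_le.2 fun w hw => subset_span hw
      exact h3 h1
    have h4 : a (Pi.single j 1) = Pi.single j 1 := by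
      ext i
      rw [ha]
      rcases eq_or_ne i j with rfl | h
      · simp
      · simp [h]
    have h5 := smul_mem _ (v j) h2
    rwa [h4, ← Pi.single_smul', smul_eq_mul, mul_one] at h5
  obtain ⟨f, hf, hfS⟩ := exists_le_ker_of_lt_top _ (lt_top_iff_ne_top.2 hne)
  let g : (ι → F) →ₗ[F] F := ∑ j, f (Pi.single j 1) • LinearMap.proj j
  have hg : ∀ v, g v = ∑ j, f (Pi.single j 1) • v j := fun v => by simp [g]
  have hgS : span F S ≤ LinearMap.ker g := by
    refine span_le.2 fun v hv => ?_
    choose w hw using fun j => hS v hv j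
    have haw : a w = v := funext hw
    have hw0 : f w = 0 := hfS (subset_span (show a w ∈ S from haw ▸ hv))
    change g v = 0
    rw [hg, ← haw]
    have : ∑ j, f (Pi.single j 1) • a w j = algebraMap E F (f w) := by
      conv_rhs => rw [← Finset.univ_sum_single w]
      rw [map_sum, map_sum]
      refine Finset.sum_congr rfl fun j _ => ?_
      rw [ha, Algebra.smul_def, ← map_mul, mul_comm, ← smul_eq_mul (w j), ← map_smul,
        ← Pi.single_smul', smul_eq_mul, mul_one]
    rw [this, hw0, map_zero]
  intro hpS
  have h0 := hgS hpS
  rw [LinearMap.mem_ker, hg] at h0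
  have hc := Fintype.linearIndependent_iff.1 hp _ h0
  apply hf
  refine LinearMap.pi_ext fun j c => ?_
  have : (Pi.single j c : ι → E) = c • Pi.single j 1 := by
    rw [← Pi.single_smul', smul_eq_mul, mul_one]
  rw [this, map_smul, hc]
  simp

theorem min_le_finrank_span_union {K F ι κ : Type*} [Field K] [Field F] [Algebra K F] [Fintype ι]
    [DecidableEq κ]
    (p : κ → ι → F) (E : κ → IntermediateField K F) (hlin : ∀ i, LinearIndependent (E i) (p i))
    (hE : ∀ i i', i ≠ i' → ∀ j, p i j ∈ E i') (S : Set (ι → F)) (s : Finset κ)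
    (hS : ∀ i ∈ s, ∀ v ∈ S, ∀ j, v j ∈ E i) :
    min (Module.finrank F (span F S) + s.card) (Fintype.card ι) ≤
      Module.finrank F (span F (S ∪ p '' s)) := by
  induction s using Finset.induction_on with
  | empty =>
    rw [Finset.card_empty, Finset.coe_empty, Set.image_empty, Set.union_empty, add_zero]
    exact min_le_left _ _
  | insert i s his ih =>
    have ih := ih fun i' hi' => hS i' (Finset.mem_insert_of_mem hi')
    rw [Finset.card_insert_of_notMem his, Finset.coe_insert, Set.image_insert_eq,
      Set.union_insert]
    set V := S ∪ p '' s
    by_cases htop : span F V = ⊤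
    · have : span F (insert (p i) V) = ⊤ :=
        eq_top_iff.2 (htop ▸ span_mono (Set.subset_insert _ _))
      rw [this, finrank_top, Module.finrank_fintype_fun_eq_card]
      exact min_le_right _ _
    · have hnot : p i ∉ span F V := by
        refine notMem_span_of_linearIndependent (E := E i) ?_ htop (hlin i)
        rintro v (hv | ⟨i', hi', rfl⟩) j
        · exact ⟨⟨v j, hS i (Finset.mem_insert_self _ _) v hv j⟩, rfl⟩
        · exact ⟨⟨p i' j, hE i' i (by rintro rfl; exact his hi') j⟩, rfl⟩
      have hlt : span F V < span F (insert (p i) V) := by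
        refine lt_of_le_of_ne (span_mono (Set.subset_insert _ _)) fun h => hnot ?_
        rw [h]
        exact subset_span (Set.mem_insert _ _)
      have := finrank_lt_finrank_of_lt hlt
      omega

namespace AlgebraicIndependent

variable {K F : Type} [Field K] [Field F] [Algebra K F]

/-- The algebraic closure in a field of the subfield generated by a set. -/
def closureField (S : Set F) : IntermediateField K F where
  carrier := (matroid K F).closure S
  mul_mem' := by rw [matroid_closure_eq]; exact mul_mem
  add_mem' := by rw [matroid_closure_eq]; exact add_mem
  algebraMap_mem' c := by
    rw [matroid_closure_eq]
    exact isAlgebraic_algebraMap (A := F) (algebraMap K (Algebra.adjoin K S) c)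
  inv_mem' x hx := by
    rw [matroid_closure_eq] at hx ⊢
    exact IsAlgebraic.inv hx

theorem mem_closureField {S : Set F} {x : F} :
    x ∈ closureField (K := K) S ↔ x ∈ (matroid K F).closure S := Iff.rfl

theorem subset_closureField (S : Set F) : S ⊆ closureField (K := K) S :=
  (matroid K F).subset_closure S (Set.subset_univ S)

theorem eRk_le_of_subset_closureField {S T : Set F} (h : S ⊆ closureField (K := K) T) :
    (matroid K F).eRk S ≤ (matroid K F).eRk T := by
  rw [← (matroid K F).eRk_closure_eq T]
  exact (matroid K F).eRk_mono h

theorem eRk_eq_toENat_trdeg_adjoin (S : Set F) :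
    (matroid K F).eRk S = Cardinal.toENat (Algebra.trdeg K (Algebra.adjoin K S)) := by
  obtain ⟨I, hI⟩ := (matroid K F).exists_isBasis S
  have hI' := matroid_isBasis_iff.1 hI
  let u : I → Algebra.adjoin K S := fun x => ⟨x, Algebra.subset_adjoin (hI'.2.1 x.2)⟩
  have hu : AlgebraicIndependent K u := .of_comp (Algebra.adjoin K S).val hI'.1
  have hb : IsTranscendenceBasis K u := by
    rw [hu.isTranscendenceBasis_iff_isAlgebraic]
    refine ⟨fun x => ?_⟩
    have hx : IsAlgebraic (Algebra.adjoin K I) (x : F) := by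
      have h1 : (x : F) ∈ closureField (K := K) I := by
        have : Algebra.adjoin K S ≤ (closureField (K := K) I).toSubalgebra :=
          Algebra.adjoin_le hI.subset_closure
        exact this x.2
      rw [mem_closureField, matroid_closure_eq] at h1
      exact h1
    have hmap : (Algebra.adjoin K (Set.range u)).map (Algebra.adjoin K S).val =
        Algebra.adjoin K I := by
      rw [AlgHom.map_adjoin, ← Set.range_comp]
      exact congrArg _ Subtype.range_val
    let f : Algebra.adjoin K (Set.range u) →ₐ[K] Algebra.adjoin K I :=
      ((Algebra.adjoin K S).val.comp (Algebra.adjoin K (Set.range u)).val).codRestrict _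
        fun z => hmap ▸ ⟨z, z.2, rfl⟩
    have hf : Function.Surjective f := by
      rintro ⟨z, hz⟩
      rw [← hmap] at hz
      obtain ⟨w, hw, rfl⟩ := hz
      exact ⟨⟨w, hw⟩, rfl⟩
    exact hx.of_ringHom_of_comp_eq f (Algebra.adjoin K S).val hf Subtype.val_injective rfl
  rw [← hI.encard_eq_eRk, ← hb.cardinalMk_eq_trdeg]
  rfl

theorem notMem_closureField_of_algHom [Infinite K] {S : Set F} {y : F} (hy : y ≠ 0)
    (hσ : ∀ c : K, c ≠ 0 → ∃ σ : F →ₐ[K] F, (∀ x ∈ S, σ x = x) ∧ σ y = c • y) :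
    y ∉ closureField (K := K) S := by
  rw [mem_closureField, matroid_closure_eq]
  rintro ⟨P, hP, hPy⟩
  have hroot : ∀ c : K, c ≠ 0 → c • y ∈ (P.map (algebraMap (Algebra.adjoin K S) F)).roots := by
    intro c hc
    obtain ⟨σ, hσS, hσy⟩ := hσ c hc
    rw [Polynomial.mem_roots ((Polynomial.map_ne_zero_iff Subtype.val_injective).2 hP),
      Polynomial.IsRoot, Polynomial.eval_map, ← hσy]
    have hfix : ∀ z ∈ Algebra.adjoin K S, σ z = z := by
      intro z hz
      have : Algebra.adjoin K S ≤ AlgHom.equalizer σ (AlgHom.id K F) :=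
        Algebra.adjoin_le fun x hx => hσS x hx
      exact this hz
    have h1 : (σ : F →+* F).comp (algebraMap (Algebra.adjoin K S) F) =
        algebraMap (Algebra.adjoin K S) F := by
      ext z
      exact hfix z z.2
    have h2 := congrArg σ hPy
    rw [map_zero, Polynomial.aeval_def] at h2
    have h3 := Polynomial.hom_eval₂ P (algebraMap (Algebra.adjoin K S) F) (σ : F →+* F) y
    rw [h1] at h3
    exact h3.symm.trans h2
  have hinf : (((fun c : K => c • y) '' {0}ᶜ)).Infinite :=
    (Set.Finite.infinite_compl (Set.finite_singleton 0)).image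
      (smul_left_injective K hy).injOn
  classical
  apply hinf
  refine (Multiset.toFinset
    (P.map (algebraMap (Algebra.adjoin K S) F)).roots).finite_toSet.subset ?_
  rintro _ ⟨c, hc, rfl⟩
  exact Finset.mem_coe.2 (Multiset.mem_toFinset.2 (hroot c hc))

end AlgebraicIndependent

section GenericMatrix

open AlgebraicIndependent Matrix

variable {F : Type} [Field F] [Algebra ℂ F] {k r n : ℕ}

theorem Matrix.det_mem_intermediateField {m : ℕ} {E : IntermediateField ℂ F}
    {A : Matrix (Fin m) (Fin m) F} (h : ∀ i j, A i j ∈ E) : A.det ∈ E := by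
  rw [Matrix.det_apply']
  exact sum_mem fun σ _ => mul_mem (intCast_mem E _) (prod_mem fun i _ => h _ _)

/-- The set of entries of a matrix. -/
def Matrix.entries {a b : ℕ} (M : Matrix (Fin a) (Fin b) F) : Set F :=
  {x | ∃ i j, M i j = x}

/-- The set of maximal minors of a matrix, repeated columns being allowed. -/
def Matrix.maximalMinors {a b : ℕ} (M : Matrix (Fin a) (Fin b) F) : Set F :=
  Set.range fun v : Fin a → Fin b => (M.submatrix id v).det

/-- The subfield generated by the entries of all rows of a matrix but one. -/
def Matrix.rowsField {a b : ℕ} (M : Matrix (Fin a) (Fin b) F) (i : Fin a) :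
    IntermediateField ℂ F :=
  IntermediateField.adjoin ℂ {x | ∃ i', i' ≠ i ∧ ∃ j, M i' j = x}

/-- A matrix whose rows behave like independent generic points of the affine cone over an
`n`-dimensional non-degenerate projective variety. -/
structure IsGenericMatrix (n : ℕ) (M : Matrix (Fin (k + 1)) (Fin (r + 1)) F) : Prop where
  adjoin_entries : IntermediateField.adjoin ℂ M.entries = ⊤
  exists_scale : ∀ i (c : ℂ), c ≠ 0 → ∃ σ : F →ₐ[ℂ] F,
    (∀ j, σ (M i j) = c • M i j) ∧ ∀ i', i' ≠ i → ∀ j, σ (M i' j) = M i' j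
  linearIndependent : ∀ i, LinearIndependent (M.rowsField i) (M i)
  eRk_row_le : ∀ i, (matroid ℂ F).eRk (Set.range (M i)) ≤ (n + 1 : ℕ)
  le_eRk : (((n + 1) * (k + 1) : ℕ) : ℕ∞) ≤ (matroid ℂ F).eRk Set.univ

namespace IsGenericMatrix

variable {M : Matrix (Fin (k + 1)) (Fin (r + 1)) F}

theorem mem_rowsField {i i' : Fin (k + 1)} (h : i ≠ i') (j : Fin (r + 1)) :
    M i j ∈ M.rowsField i' :=
  IntermediateField.subset_adjoin _ _ ⟨i, h, j, rfl⟩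

theorem linearIndependent_rows (hM : IsGenericMatrix n M) (hk : k ≤ r) :
    LinearIndependent F M := by
  have h := min_le_finrank_span_union M M.rowsField hM.linearIndependent
    (fun i i' h j => mem_rowsField h j) ∅ Finset.univ (by simp)
  refine linearIndependent_iff_card_le_finrank_span.2 ?_
  have hr : (∅ : Set (Fin (r + 1) → F)) ∪ M '' (Finset.univ : Finset (Fin (k + 1))) =
      Set.range M := by
    rw [Set.empty_union, Finset.coe_univ]
    exact Set.image_univ
  rw [hr] at h
  rw [Set.finrank]
  simp only [Finset.card_univ, Fintype.card_fin] at h ⊢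
  omega

theorem exists_det_ne_zero (hM : IsGenericMatrix n M) (hk : k ≤ r) :
    ∃ e : Fin (k + 1) → Fin (r + 1), (M.submatrix id e).det ≠ 0 := by
  have hrank : M.rank = k + 1 := by
    have : LinearIndependent F M.row := hM.linearIndependent_rows hk
    simpa using this.rank_matrix
  rw [Matrix.rank_eq_finrank_span_cols] at hrank
  have h := exists_fun_fin_finrank_span_eq F (Set.range M.col)
  rw [hrank] at h
  obtain ⟨f, hf, -, hli⟩ := h
  choose e he using hf
  refine ⟨e, ?_⟩
  have hcol : (M.submatrix id e).col = f := funext he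
  rw [← hcol, Matrix.linearIndependent_cols_iff_isUnit, Matrix.isUnit_iff_isUnit_det] at hli
  exact hli.ne_zero

theorem finrank_inf_le (hM : IsGenericMatrix n M) (i : Fin (k + 1))
    {t : Set (Fin (r + 1) → F)} (ht : t.encard ≤ (n + 1 : ℕ))
    (htE : ∀ v ∈ t, ∀ j, v j ∈ IntermediateField.adjoin ℂ (Set.range (M i))) :
    Module.finrank F (span F t ⊓ span F (Set.range M) : Submodule F (Fin (r + 1) → F)) ≤
      max 1 (n + 1 + k - r) := by
  classical
  have h1 := min_le_finrank_span_union M M.rowsField hM.linearIndependent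
    (fun i i' h j => mem_rowsField h j) t (Finset.univ.erase i) (by
      intro i' hi' v hv j
      have : IntermediateField.adjoin ℂ (Set.range (M i)) ≤ M.rowsField i' := by
        rw [IntermediateField.adjoin_le_iff]
        rintro _ ⟨j, rfl⟩
        exact mem_rowsField (Finset.ne_of_mem_erase hi').symm j
      exact this (htE v hv j))
  set P := M '' (Finset.univ.erase i : Finset (Fin (k + 1)))
  have htc : Module.finrank F (span F t) ≤ n + 1 := by
    have htf : t.Finite := Set.finite_of_encard_le_coe ht
    have := htf.fintype
    refine (finrank_span_le_card t).trans ?_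
    rw [← Set.ncard_eq_toFinset_card']
    rwa [← htf.cast_ncard_eq, Nat.cast_le] at ht
  have hPc : Module.finrank F (span F P) ≤ k := by
    have : P = (((Finset.univ.erase i).image M.row : Finset (Fin (r + 1) → F)) : Set _) := by
      rw [Finset.coe_image]
      rfl
    rw [this]
    refine (finrank_span_finset_le_card _).trans (Finset.card_image_le.trans ?_)
    simp
  have h2 : Module.finrank F (span F (Set.range M)) ≤ Module.finrank F (span F P) + 1 := by
    have : Set.range M = P ∪ {M i} := by
      ext v
      constructor
      · rintro ⟨i', rfl⟩
        by_cases h : i' = i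
        · exact Or.inr (by rw [h]; rfl)
        · exact Or.inl ⟨i', by simp [h], rfl⟩
      · rintro (⟨i', -, rfl⟩ | rfl) <;> exact ⟨_, rfl⟩
    rw [this, span_union]
    refine (Submodule.finrank_add_le_finrank_add_finrank _ _).trans ?_
    have : Module.finrank F (span F {M i}) ≤ 1 := by
      simpa using finrank_span_le_card (R := F) ({M i} : Set (Fin (r + 1) → F))
    omega
  have h3 := Submodule.finrank_sup_add_finrank_inf_eq (span F t) (span F P)
  have h4 := Submodule.finrank_sup_add_finrank_inf_eq (span F t ⊓ span F (Set.range M)) (span F P)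
  have hPM : span F P ≤ span F (Set.range M) := span_mono (Set.image_subset_range _ _)
  have h5 := Submodule.finrank_mono
    (sup_le inf_le_right hPM : span F t ⊓ span F (Set.range M) ⊔ span F P ≤ _)
  have h6 : span F t ⊓ span F (Set.range M) ⊓ span F P = span F t ⊓ span F P := by
    rw [inf_assoc, inf_eq_right.2 hPM]
  rw [h6] at h4
  rw [span_union] at h1
  simp only [Finset.card_erase_of_mem (Finset.mem_univ i), Finset.card_univ,
    Fintype.card_fin] at h1
  omega

end IsGenericMatrix

namespace IsGenericMatrix

variable {M : Matrix (Fin (k + 1)) (Fin (r + 1)) F}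

theorem derivation_mem_span {e : Fin (k + 1) → Fin (r + 1)}
    {C : Matrix (Fin (k + 1)) (Fin (r + 1)) F}
    (hd : (M.submatrix id e).det ≠ 0) (hC : M.submatrix id e * C = M)
    (D : Derivation ℂ F F) (hD : ∀ x ∈ C.entries, D x = 0) (i : Fin (k + 1)) :
    (fun j => D (M i j)) ∈ span F (Set.range M) := by
  have hCM : ∀ c, C c ∈ span F (Set.range M) := by
    intro c
    have h1 : (M.submatrix id e)⁻¹ * M = C :=
      (congrArg ((M.submatrix id e)⁻¹ * ·) hC.symm).trans
        (Matrix.nonsing_inv_mul_cancel_left _ _ hd.isUnit)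
    have : C c = ∑ i, (M.submatrix id e)⁻¹ c i • M i := by
      ext j
      rw [← h1]
      simp [Matrix.mul_apply, Finset.sum_apply]
    rw [this]
    exact sum_mem fun i _ => smul_mem _ _ (subset_span ⟨i, rfl⟩)
  have : (fun j => D (M i j)) = ∑ c, D (M i (e c)) • C c := by
    ext j
    conv_lhs => rw [← hC]
    rw [Matrix.mul_apply, map_sum, Finset.sum_apply]
    refine Finset.sum_congr rfl fun c _ => ?_
    rw [Derivation.leibniz, hD _ ⟨c, j, rfl⟩, smul_zero, zero_add, Pi.smul_apply, smul_eq_mul,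
      smul_eq_mul, mul_comm]
    rfl
  rw [this]
  exact sum_mem fun c _ => smul_mem _ _ (hCM c)

theorem le_of_eRk_entries_le (hM : IsGenericMatrix n M) (hk : k ≤ r)
    {e : Fin (k + 1) → Fin (r + 1)} {C : Matrix (Fin (k + 1)) (Fin (r + 1)) F}
    (hd : (M.submatrix id e).det ≠ 0) (hC : M.submatrix id e * C = M)
    {b : ℕ} (hb : (matroid ℂ F).eRk C.entries ≤ b) :
    min n (r - k) * (k + 1) ≤ b := by
  obtain ⟨D, hDli, hD⟩ := exists_linearIndependent_derivation hM.le_eRk hb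
  choose t htc htE ht using fun i => exists_derivation_mem_span (M i) (hM.eRk_row_le i)
  let Λ := span F (Set.range M)
  let V : Fin (k + 1) → Submodule F (Fin (r + 1) → F) := fun i => span F (t i) ⊓ Λ
  let Ψ : Derivation ℂ F F →ₗ[F] (Fin (k + 1) → Fin (r + 1) → F) :=
    { toFun := fun D i j => D (M i j)
      map_add' := fun _ _ => rfl
      map_smul' := fun _ _ => rfl }
  have hΨ : LinearMap.ker Ψ = ⊥ := by
    refine LinearMap.ker_eq_bot'.2 fun D hD => ?_
    have h1 : (⊤ : IntermediateField ℂ F) ≤ D.constants := by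
      rw [← hM.adjoin_entries, IntermediateField.adjoin_le_iff]
      rintro _ ⟨i, j, rfl⟩
      exact Derivation.mem_constants.2 (congrFun (congrFun hD i) j)
    ext x
    exact Derivation.mem_constants.1 (h1 (IntermediateField.mem_top (x := x)))
  let ι : (∀ i, V i) →ₗ[F] (Fin (k + 1) → Fin (r + 1) → F) :=
    LinearMap.pi fun i => (V i).subtype ∘ₗ LinearMap.proj i
  let w : Fin ((n + 1) * (k + 1) - b) → ∀ i, V i := fun s i =>
    ⟨fun j => D s (M i j), ht i (D s), derivation_mem_span hd hC (D s) (hD s) i⟩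
  have hw : LinearIndependent F w := by
    refine LinearIndependent.of_comp ι ?_
    exact hDli.map' Ψ hΨ
  have h1 := hw.fintype_card_le_finrank
  rw [Fintype.card_fin, Module.finrank_pi_fintype] at h1
  have h2 : ∑ i, Module.finrank F (V i) ≤ max 1 (n + 1 + k - r) * (k + 1) := by
    refine (Finset.sum_le_card_nsmul _ _ _ fun i _ => hM.finrank_inf_le i (htc i) (htE i)).trans ?_
    simp [mul_comm]
  have h3 : n + 1 = max 1 (n + 1 + k - r) + min n (r - k) := by omega
  have h4 : (n + 1) * (k + 1) =
      max 1 (n + 1 + k - r) * (k + 1) + min n (r - k) * (k + 1) := by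
    rw [← add_mul, ← h3]
  omega

/-- Scaling the first row rescales a maximal minor and fixes the row reduced matrix. -/
theorem det_notMem_closureField (hM : IsGenericMatrix n M)
    {e : Fin (k + 1) → Fin (r + 1)} {C : Matrix (Fin (k + 1)) (Fin (r + 1)) F}
    (hd : (M.submatrix id e).det ≠ 0) (hC : M.submatrix id e * C = M) :
    (M.submatrix id e).det ∉ closureField (K := ℂ) C.entries := by
  refine notMem_closureField_of_algHom hd fun c hc => ?_
  obtain ⟨σ, hσ0, hσ⟩ := hM.exists_scale 0 c hc
  have hrow : ∀ i j, σ (M i j) = (if i = 0 then algebraMap ℂ F c else 1) * M i j := by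
    intro i j
    split_ifs with h
    · rw [h, hσ0, Algebra.smul_def]
    · rw [hσ i h, one_mul]
  have hc' : ∀ i : Fin (k + 1), (if i = 0 then algebraMap ℂ F c else 1) ≠ 0 := by
    intro i
    split_ifs
    · simpa using hc
    · exact one_ne_zero
  refine ⟨σ, ?_, ?_⟩
  · rintro _ ⟨a, j, rfl⟩
    have h1 : M.submatrix id e * C.map σ = M := by
      ext i j
      have h2 := congrArg σ (congrFun (congrFun hC i) j)
      rw [Matrix.mul_apply, map_sum, hrow] at h2
      refine mul_left_cancel₀ (hc' i) (Eq.trans ?_ h2)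
      rw [Matrix.mul_apply, Finset.mul_sum]
      refine Finset.sum_congr rfl fun c _ => ?_
      rw [map_mul, submatrix_apply, id, hrow, mul_assoc]
      rfl
    have h2 : C.map σ = C := by
      have h2 := congrArg ((M.submatrix id e)⁻¹ * ·) (h1.trans hC.symm)
      rwa [Matrix.nonsing_inv_mul_cancel_left _ _ hd.isUnit,
        Matrix.nonsing_inv_mul_cancel_left _ _ hd.isUnit] at h2
    exact congrFun (congrFun h2 a) j
  · rw [Algebra.smul_def, AlgHom.map_det]
    have : σ.mapMatrix (M.submatrix id e) =
        Matrix.of fun i j => (if i = 0 then algebraMap ℂ F c else 1) * M.submatrix id e i j := by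
      ext i j
      exact hrow i (e j)
    rw [this, Matrix.det_mul_column]
    simp

end IsGenericMatrix

section RowReduced

variable {M C : Matrix (Fin (k + 1)) (Fin (r + 1)) F} {e : Fin (k + 1) → Fin (r + 1)}

theorem insert_det_subset_closureField_maximalMinors
    (hd : (M.submatrix id e).det ≠ 0) (hC : M.submatrix id e * C = M) :
    insert (M.submatrix id e).det C.entries ⊆
      (closureField (K := ℂ) M.maximalMinors : Set F) := by
  have hmin : ∀ v, (M.submatrix id v).det ∈ closureField (K := ℂ) M.maximalMinors :=
    fun v => subset_closureField _ ⟨v, rfl⟩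
  rintro _ (rfl | ⟨c, j, rfl⟩)
  · exact hmin e
  · have h1 : (M.submatrix id e).det * C c j =
        (M.submatrix id (Function.update e c j)).det := by
      have h0 : (M.submatrix id e).adjugate * (M.submatrix id e * C) =
          (M.submatrix id e).det • C := by
        rw [← Matrix.mul_assoc, Matrix.adjugate_mul, Matrix.smul_mul, Matrix.one_mul]
      have h2 := congrFun (congrFun
        (h0.symm.trans (congrArg ((M.submatrix id e).adjugate * ·) hC)) c) j
      refine Eq.trans h2 ?_
      have h3 := congrFun (cramer_eq_adjugate_mulVec (M.submatrix id e) (fun i => M i j)) c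
      refine h3.symm.trans ?_
      rw [cramer_apply]
      congr 1
      ext i j'
      by_cases h : j' = c
      · subst h; simp
      · simp [h]
    rw [eq_div_of_mul_eq hd ((mul_comm _ _).trans h1)]
    exact div_mem (hmin _) (hmin e)

theorem maximalMinors_subset_closureField_insert_det (hC : M.submatrix id e * C = M) :
    M.maximalMinors ⊆
      (closureField (K := ℂ) (insert (M.submatrix id e).det C.entries) : Set F) := by
  rintro _ ⟨v, rfl⟩
  have : (M.submatrix id v).det = (M.submatrix id e).det * (C.submatrix id v).det := by
    rw [← Matrix.det_mul]
    exact congrArg (fun A : Matrix _ _ F => (A.submatrix id v).det) hC.symm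
  dsimp only
  rw [this]
  refine mul_mem (subset_closureField _ (Set.mem_insert _ _))
    (Matrix.det_mem_intermediateField fun i j => ?_)
  exact subset_closureField _ (Set.mem_insert_of_mem _ ⟨i, v j, rfl⟩)

theorem eRk_entries_le (hd : (M.submatrix id e).det ≠ 0) (hC : M.submatrix id e * C = M) :
    (matroid ℂ F).eRk C.entries ≤ ((r - k) * (k + 1) : ℕ) := by
  classical
  have he : Function.Injective e := by
    intro a b hab
    by_contra h
    exact hd (Matrix.det_zero_of_column_eq h fun i => by simp [hab])
  have hone : C.submatrix id e = 1 := by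
    have h2 : M.submatrix id e * C.submatrix id e = M.submatrix id e * 1 := by
      rw [Matrix.mul_one]
      exact congrArg (fun A : Matrix _ _ F => A.submatrix id e) hC
    have h3 := congrArg ((M.submatrix id e)⁻¹ * ·) h2
    rwa [Matrix.nonsing_inv_mul_cancel_left _ _ hd.isUnit,
      Matrix.nonsing_inv_mul_cancel_left _ _ hd.isUnit] at h3
  let S : Finset F := ((Finset.univ.image e)ᶜ ×ˢ Finset.univ).image fun x => C x.2 x.1
  have hS : S.card ≤ (r - k) * (k + 1) := by
    refine Finset.card_image_le.trans (le_of_eq ?_)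
    rw [Finset.card_product, Finset.card_compl, Finset.card_image_of_injective _ he]
    simp
  have hCS : C.entries ⊆ (closureField (K := ℂ) (S : Set F) : Set F) := by
    rintro _ ⟨c, j, rfl⟩
    by_cases hj : ∃ a, e a = j
    · obtain ⟨a, rfl⟩ := hj
      have : C c (e a) = (1 : Matrix (Fin (k + 1)) (Fin (k + 1)) F) c a := by
        rw [← hone]; rfl
      rw [this, Matrix.one_apply]
      split_ifs
      · exact one_mem _
      · exact zero_mem _
    · refine subset_closureField _ (Finset.mem_coe.2 (Finset.mem_image.2 ⟨(j, c), ?_, rfl⟩))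
      simpa using hj
  refine (eRk_le_of_subset_closureField hCS).trans (((matroid ℂ F).eRk_le_encard _).trans ?_)
  rw [Set.encard_coe_eq_coe_finsetCard]
  exact_mod_cast hS

end RowReduced

namespace IsGenericMatrix

variable {M : Matrix (Fin (k + 1)) (Fin (r + 1)) F}

theorem eRk_range_div_le (hM : IsGenericMatrix n M) (i : Fin (k + 1)) :
    (matroid ℂ F).eRk (Set.range fun j => M i j / M i 0) ≤ (n : ℕ) := by
  have hi : M i 0 ≠ 0 := (hM.linearIndependent i).ne_zero 0
  have hnot : M i 0 ∉ closureField (K := ℂ) (Set.range fun j => M i j / M i 0) := by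
    refine notMem_closureField_of_algHom hi fun c hc => ?_
    obtain ⟨σ, hσ, -⟩ := hM.exists_scale i c hc
    refine ⟨σ, ?_, hσ 0⟩
    rintro _ ⟨j, rfl⟩
    have hc' : algebraMap ℂ F c ≠ 0 := by simpa using hc
    dsimp only
    rw [map_div₀, hσ, hσ, Algebra.smul_def, Algebra.smul_def, mul_div_mul_left _ _ hc']
  have h1 := (matroid ℂ F).eRk_insert_eq_add_one
    (X := Set.range fun j => M i j / M i 0) (e := M i 0) ⟨Set.mem_univ _, hnot⟩
  have h2 : insert (M i 0) (Set.range fun j => M i j / M i 0) ⊆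
      (closureField (K := ℂ) (Set.range (M i)) : Set F) := by
    have h : ∀ j, M i j ∈ closureField (K := ℂ) (Set.range (M i)) :=
      fun j => subset_closureField _ ⟨j, rfl⟩
    rintro _ (rfl | ⟨j, rfl⟩)
    · exact h 0
    · exact div_mem (h j) (h 0)
  have h3 := (eRk_le_of_subset_closureField h2).trans (hM.eRk_row_le i)
  rw [h1, Nat.cast_add, Nat.cast_one] at h3
  exact (ENat.add_le_add_iff_right ENat.one_ne_top).1 h3

theorem eRk_maximalMinors_le (hM : IsGenericMatrix n M) :
    (matroid ℂ F).eRk M.maximalMinors ≤ (n * (k + 1) + 1 : ℕ) := by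
  let N : Fin (k + 1) → Set F := fun i => Set.range fun j => M i j / M i 0
  have hN : ∀ s : Finset (Fin (k + 1)),
      (matroid ℂ F).eRk (⋃ i ∈ s, N i) ≤ (n * s.card : ℕ) := by
    intro s
    induction s using Finset.induction_on with
    | empty => simp
    | insert i s hi ih =>
      rw [Finset.set_biUnion_insert, Finset.card_insert_of_notMem hi, mul_add, mul_one,
        add_comm (n * _), Nat.cast_add]
      exact ((matroid ℂ F).eRk_union_le_eRk_add_eRk _ _).trans
        (add_le_add (hM.eRk_range_div_le i) ih)
  have h1 : M.maximalMinors ⊆ (closureField (K := ℂ)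
      (insert (∏ i, M i 0) (⋃ i ∈ (Finset.univ : Finset (Fin (k + 1))), N i)) : Set F) := by
    rintro _ ⟨v, rfl⟩
    have h2 : (M.submatrix id v).det =
        (∏ i, M i 0) * (Matrix.of fun i j => M i (v j) / M i 0).det := by
      rw [← Matrix.det_mul_column]
      congr 1
      ext i j
      have hi : M i 0 ≠ 0 := (hM.linearIndependent i).ne_zero 0
      simp [mul_div_cancel₀ _ hi]
    dsimp only
    rw [h2]
    refine mul_mem (subset_closureField _ (Set.mem_insert _ _))
      (Matrix.det_mem_intermediateField fun i j => ?_)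
    refine subset_closureField _ (Set.mem_insert_of_mem _ ?_)
    simp only [Finset.mem_univ, Set.iUnion_true, Set.mem_iUnion]
    exact ⟨i, v j, rfl⟩
  refine (eRk_le_of_subset_closureField h1).trans
    (((matroid ℂ F).eRk_insert_le_add_one _ _).trans ?_)
  rw [Nat.cast_add, Nat.cast_one]
  refine add_le_add_left ((hN _).trans (le_of_eq ?_)) _
  simp

theorem eRk_maximalMinors (hM : IsGenericMatrix n M) (hk : k ≤ r) :
    (matroid ℂ F).eRk M.maximalMinors =
      (min (n * (k + 1)) ((r - k) * (k + 1)) + 1 : ℕ) := by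
  obtain ⟨e, hd⟩ := hM.exists_det_ne_zero hk
  let C := (M.submatrix id e)⁻¹ * M
  have hC : M.submatrix id e * C = M := Matrix.mul_nonsing_inv_cancel_left _ _ hd.isUnit
  have hins := (matroid ℂ F).eRk_insert_eq_add_one
    ⟨Set.mem_univ _, hM.det_notMem_closureField hd hC⟩
  have hup := eRk_le_of_subset_closureField (maximalMinors_subset_closureField_insert_det hC)
  have hlow := eRk_le_of_subset_closureField (insert_det_subset_closureField_maximalMinors hd hC)
  rw [hins] at hup hlow
  have hle := eRk_entries_le hd hC
  obtain ⟨b, hb⟩ := ENat.ne_top_iff_exists.1 (ne_top_of_le_ne_top (ENat.natCast_ne_top _) hle)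
  have hb' := hM.le_of_eRk_entries_le hk hd hC hb.ge
  have hup' := hM.eRk_maximalMinors_le
  rw [← hb] at hle hlow hup
  have heq : (matroid ℂ F).eRk M.maximalMinors = ((b + 1 : ℕ) : ℕ∞) := by
    exact_mod_cast le_antisymm hup hlow
  rw [heq] at hup' ⊢
  rw [Nat.cast_le] at hup' hle
  rw [← min_mul_of_nonneg n (r - k) (Nat.zero_le (k + 1))]
  congr 2
  refine le_antisymm ?_ hb'
  rw [min_mul_of_nonneg n (r - k) (Nat.zero_le (k + 1))]
  omega

end IsGenericMatrix

end GenericMatrix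

theorem polyFun_pi (ι : Type*) [Finite ι] :
    PolyFun (ι → ℂ) = Algebra.adjoin ℂ (Set.range fun (j : ι) (x : ι → ℂ) => x j) := by
  classical
  cases nonempty_fintype ι
  apply le_antisymm
  · refine Algebra.adjoin_le fun f hf => ?_
    have : f = ∑ j, f (Pi.single j 1) • fun x : ι → ℂ => x j := by
      ext x
      have h1 := congrArg (IsLinearMap.mk' f hf) (pi_eq_sum_univ' x)
      rw [map_sum] at h1
      simp only [map_smul, IsLinearMap.mk'_apply, smul_eq_mul] at h1
      rw [h1, Finset.sum_apply]
      refine Finset.sum_congr rfl fun j _ => ?_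
      rw [Pi.smul_apply, smul_eq_mul, mul_comm]
    rw [this]
    exact sum_mem fun j _ => Subalgebra.smul_mem _ (Algebra.subset_adjoin (Set.mem_range_self j)) _
  · refine Algebra.adjoin_mono ?_
    rintro _ ⟨j, rfl⟩
    exact (LinearMap.proj j : (ι → ℂ) →ₗ[ℂ] ℂ).isLinear

section ProductAlgebra

variable {κ ι : Type} (X : Set (ι → ℂ))

/-- The algebra of functions on a power of `X` generated by the coordinate functions. -/
def prodAlg (κ : Type) : Subalgebra ℂ ((κ → X) → ℂ) :=
  Algebra.adjoin ℂ {f | ∃ i j, (fun p : κ → X => (p i : ι → ℂ) j) = f}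

/-- The algebra of polynomial functions on `X`. -/
def polyAlg : Subalgebra ℂ (X → ℂ) :=
  Algebra.adjoin ℂ (Set.range fun (j : ι) (x : X) => (x : ι → ℂ) j)

theorem coordAlg_subtypeVal [Finite ι] : coordAlg (Subtype.val : X → ι → ℂ) = polyAlg X := by
  rw [coordAlg, polyFun_pi, AlgHom.map_adjoin, ← Set.range_comp]
  rfl

variable {X}

theorem exists_mul_ne_zero_of_isIrrAlg [Finite ι] (hX : IsIrrAlg X) {f g : X → ℂ}
    (hf : f ∈ polyAlg X) (hg : g ∈ polyAlg X) (hf0 : ∃ x, f x ≠ 0) (hg0 : ∃ x, g x ≠ 0) :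
    ∃ x, f x ≠ 0 ∧ g x ≠ 0 := by
  rw [← coordAlg_subtypeVal] at hf hg
  obtain ⟨f, hf, rfl⟩ := hf
  obtain ⟨g, hg, rfl⟩ := hg
  by_contra! h
  have key : ∀ f ∈ PolyFun (ι → ℂ), IsAlgSet {x : ι → ℂ | f x = 0} := fun f hf =>
    ⟨{f}, by simpa using hf, by simp⟩
  obtain ⟨x, hx⟩ := hf0
  obtain ⟨y, hy⟩ := hg0
  rcases hX.2.2 _ _ (key f hf) (key g hg) fun z hz => by
      by_cases hz' : f z = 0
      · exact Or.inl hz'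
      · exact Or.inr (h ⟨z, hz⟩ hz') with h | h
  · exact hx (h x.2)
  · exact hy (h y.2)

theorem pullback_mem_polyAlg {f : (κ → X) → ℂ} (hf : f ∈ prodAlg X κ) (φ : X → κ → X)
    (hφ : ∀ i, (∀ x, φ x i = x) ∨ ∃ y, ∀ x, φ x i = y) : pullback φ f ∈ polyAlg X := by
  have : prodAlg X κ ≤ (polyAlg X).comap (pullback φ) := by
    refine Algebra.adjoin_le ?_
    rintro _ ⟨i, j, rfl⟩
    change (fun x => (φ x i : ι → ℂ) j) ∈ polyAlg X
    rcases hφ i with h | ⟨y, h⟩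
    · simp only [h]
      exact Algebra.subset_adjoin ⟨j, rfl⟩
    · simp only [h]
      exact (polyAlg X).algebraMap_mem ((y : ι → ℂ) j)
  exact this hf

theorem update_eq_self_or_const [DecidableEq κ] (p : κ → X) (i i' : κ) :
    (∀ x, Function.update p i x i' = x) ∨ ∃ y, ∀ x, Function.update p i x i' = y := by
  by_cases h : i' = i
  · subst h; simp
  · exact Or.inr ⟨p i', fun x => Function.update_of_ne h _ _⟩

theorem exists_mul_ne_zero_of_mem_prodAlg [Finite ι] [Finite κ] (hX : IsIrrAlg X)
    {f g : (κ → X) → ℂ}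
    (hf : f ∈ prodAlg X κ) (hg : g ∈ prodAlg X κ) (hf0 : ∃ x, f x ≠ 0) (hg0 : ∃ x, g x ≠ 0) :
    ∃ x, f x ≠ 0 ∧ g x ≠ 0 := by
  classical
  cases nonempty_fintype κ
  have key : ∀ s : Finset κ, ∃ p q, f p ≠ 0 ∧ g q ≠ 0 ∧ ∀ i ∈ s, p i = q i := by
    intro s
    induction s using Finset.induction_on with
    | empty =>
      obtain ⟨p, hp⟩ := hf0
      obtain ⟨q, hq⟩ := hg0
      exact ⟨p, q, hp, hq, by simp⟩
    | insert i s hi ih =>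
      obtain ⟨p, q, hp, hq, hpq⟩ := ih
      obtain ⟨x, hx⟩ := exists_mul_ne_zero_of_isIrrAlg hX
        (pullback_mem_polyAlg hf _ (update_eq_self_or_const p i))
        (pullback_mem_polyAlg hg _ (update_eq_self_or_const q i))
        ⟨p i, by simpa using hp⟩ ⟨q i, by simpa using hq⟩
      refine ⟨_, _, hx.1, hx.2, fun i' hi' => ?_⟩
      by_cases h : i' = i
      · subst h; simp
      · simpa [h] using hpq i' ((Finset.mem_insert.1 hi').resolve_left h)
  obtain ⟨p, q, hp, hq, hpq⟩ := key Finset.univ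
  obtain rfl : p = q := funext fun i => hpq i (Finset.mem_univ i)
  exact ⟨p, hp, hq⟩

theorem isDomain_of_exists_mul_ne_zero {T : Type*} [Nonempty T] (A : Subalgebra ℂ (T → ℂ))
    (h : ∀ f ∈ A, ∀ g ∈ A, (∃ x, f x ≠ 0) → (∃ x, g x ≠ 0) → ∃ x, f x ≠ 0 ∧ g x ≠ 0) :
    IsDomain A := by
  have : NoZeroDivisors A := by
    refine ⟨fun {f g} hfg => ?_⟩
    by_contra! hne
    have key : ∀ f : A, f ≠ 0 → ∃ x, (f : T → ℂ) x ≠ 0 := by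
      intro f hf
      by_contra! h0
      exact hf (Subtype.ext (funext h0))
    obtain ⟨x, hx, hx'⟩ := h f f.2 g g.2 (key f hne.1) (key g hne.2)
    exact mul_ne_zero hx hx' (congrFun (congrArg Subtype.val hfg) x)
  exact NoZeroDivisors.to_isDomain A

theorem isDomain_polyAlg [Finite ι] (hX : IsIrrAlg X) : IsDomain (polyAlg X) :=
  have := hX.1.to_subtype
  isDomain_of_exists_mul_ne_zero _ fun _ hf _ hg => exists_mul_ne_zero_of_isIrrAlg hX hf hg

theorem isDomain_prodAlg [Finite ι] [Finite κ] (hX : IsIrrAlg X) : IsDomain (prodAlg X κ) :=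
  have := hX.1.to_subtype
  isDomain_of_exists_mul_ne_zero _ fun _ hf _ hg => exists_mul_ne_zero_of_mem_prodAlg hX hf hg

end ProductAlgebra

section CoordinateMatrix

open Matrix MvPolynomial
open scoped IntermediateField.algebraAdjoinAdjoin

theorem algebraicIndependent_iff_linearIndependent_monomial {R A ι : Type*} [CommRing R]
    [CommRing A] [Algebra R A] {x : ι → A} :
    AlgebraicIndependent R x ↔
      LinearIndependent R fun d : ι →₀ ℕ => aeval x (monomial d (1 : R)) := by
  constructor
  · intro h
    have := (basisMonomials ι R).linearIndependent.map' (aeval x).toLinearMap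
      (LinearMap.ker_eq_bot.2 h)
    simpa [Function.comp_def] using this
  · intro h
    refine (injective_iff_map_eq_zero _).2 fun P hP => ?_
    rw [P.as_sum, map_sum] at hP
    have hP' : ∑ d ∈ P.support, P.coeff d • aeval x (monomial d (1 : R)) = 0 := by
      rw [← hP]
      refine Finset.sum_congr rfl fun d _ => ?_
      rw [← map_smul, smul_monomial, smul_eq_mul, mul_one]
    have h1 := linearIndependent_iff'.1 h _ _ hP'
    ext d
    rw [coeff_zero]
    by_cases hd : d ∈ P.support
    · exact h1 d hd
    · exact notMem_support_iff.1 hd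

section FunctionField

variable {r k : ℕ} {X : Set (Fin (r + 1) → ℂ)}

/-- Pull back of a function on `X` to the power of `X` along a projection. -/
def ofRow (i : Fin (k + 1)) : polyAlg X →ₐ[ℂ] prodAlg X (Fin (k + 1)) :=
  ((pullback fun p : Fin (k + 1) → X => p i).comp (polyAlg X).val).codRestrict _ fun f => by
    have : polyAlg X ≤ (prodAlg X (Fin (k + 1))).comap
        (pullback fun p : Fin (k + 1) → X => p i) := by
      refine Algebra.adjoin_le ?_
      rintro _ ⟨j, rfl⟩
      exact Algebra.subset_adjoin ⟨i, j, rfl⟩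
    exact this f.2

theorem ofRow_apply (i : Fin (k + 1)) (f : polyAlg X) (p : Fin (k + 1) → X) :
    (ofRow i f : (Fin (k + 1) → X) → ℂ) p = (f : X → ℂ) (p i) := rfl

theorem ofRow_injective (i : Fin (k + 1)) :
    Function.Injective (ofRow i : polyAlg X → prodAlg X (Fin (k + 1))) := by
  intro f g h
  ext x
  exact congrFun (congrArg Subtype.val h) fun _ => x

/-- The coordinates of the points of `X`, as functions on `X`. -/
def coordFun (j : Fin (r + 1)) : polyAlg X := ⟨fun x => (x : Fin (r + 1) → ℂ) j,
  Algebra.subset_adjoin (Set.mem_range_self j)⟩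

theorem adjoin_coordFun :
    Algebra.adjoin ℂ (Set.range (coordFun : Fin (r + 1) → polyAlg X)) = ⊤ := by
  refine Eq.trans ?_ (Algebra.adjoin_adjoin_coe_preimage (R := ℂ)
    (s := Set.range fun (j : Fin (r + 1)) (x : X) => (x : Fin (r + 1) → ℂ) j))
  congr 1
  ext f
  exact exists_congr fun j => Subtype.ext_iff

theorem adjoin_ofRow_coordFun :
    Algebra.adjoin ℂ {f : prodAlg X (Fin (k + 1)) | ∃ i j, ofRow i (coordFun j) = f} = ⊤ := by
  refine Eq.trans ?_ (Algebra.adjoin_adjoin_coe_preimage (R := ℂ)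
    (s := {f | ∃ i j, (fun p : Fin (k + 1) → X => (p i : Fin (r + 1) → ℂ) j) = f}))
  congr 1
  ext f
  exact exists_congr fun i => exists_congr fun j => Subtype.ext_iff

variable (F : Type) [Field F] [Algebra ℂ F] [Algebra (prodAlg X (Fin (k + 1))) F]

variable (X k) in
/-- The matrix of coordinate functions on the power of `X`. -/
def coordMatrix : Matrix (Fin (k + 1)) (Fin (r + 1)) F :=
  fun i j => algebraMap (prodAlg X (Fin (k + 1))) F (ofRow i (coordFun j))

variable [IsScalarTower ℂ (prodAlg X (Fin (k + 1))) F]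
  [IsFractionRing (prodAlg X (Fin (k + 1))) F]

theorem adjoin_entries_coordMatrix :
    IntermediateField.adjoin ℂ (coordMatrix k X F).entries = ⊤ := by
  rw [eq_top_iff]
  rintro x -
  have key : ∀ a : prodAlg X (Fin (k + 1)),
      algebraMap (prodAlg X (Fin (k + 1))) F a ∈
        IntermediateField.adjoin ℂ (coordMatrix k X F).entries := by
    have : (⊤ : Subalgebra ℂ (prodAlg X (Fin (k + 1)))) ≤
        (IntermediateField.adjoin ℂ (coordMatrix k X F).entries).toSubalgebra.comap
          (IsScalarTower.toAlgHom ℂ (prodAlg X (Fin (k + 1))) F) := by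
      rw [← adjoin_ofRow_coordFun]
      refine Algebra.adjoin_le ?_
      rintro _ ⟨i, j, rfl⟩
      exact IntermediateField.subset_adjoin _ _ ⟨i, j, rfl⟩
    exact fun a => this Algebra.mem_top
  obtain ⟨a, b, -, rfl⟩ := IsFractionRing.div_surjective (A := prodAlg X (Fin (k + 1))) x
  exact div_mem (key a) (key b)

theorem exists_scale_coordMatrix (hX : IsCone X) (i : Fin (k + 1)) {c : ℂ} (hc : c ≠ 0) :
    ∃ σ : F →ₐ[ℂ] F,
      (∀ j, σ (coordMatrix k X F i j) = c • coordMatrix k X F i j) ∧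
      ∀ i', i' ≠ i → ∀ j, σ (coordMatrix k X F i' j) = coordMatrix k X F i' j := by
  let s : ℂ → (Fin (k + 1) → X) → Fin (k + 1) → X := fun c p =>
    Function.update p i ⟨c • (p i : Fin (r + 1) → ℂ), hX.2 c _ (p i).2⟩
  have hs : ∀ p, s c (s c⁻¹ p) = p := by
    intro p
    ext i' j
    by_cases h : i' = i
    · subst h; simp [s, hc]
    · simp [s, h]
  have hs1 : ∀ j p, (s c p i : Fin (r + 1) → ℂ) j = c * (p i : Fin (r + 1) → ℂ) j := by
    intro j p; simp [s]
  have hs2 : ∀ i', i' ≠ i → ∀ p, s c p i' = p i' := by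
    intro i' h p; simp [s, h]
  have hmem : ∀ f ∈ prodAlg X (Fin (k + 1)), pullback (s c) f ∈ prodAlg X (Fin (k + 1)) := by
    have : prodAlg X (Fin (k + 1)) ≤ (prodAlg X (Fin (k + 1))).comap (pullback (s c)) := by
      refine Algebra.adjoin_le ?_
      rintro _ ⟨i', j, rfl⟩
      change (fun p => (s c p i' : Fin (r + 1) → ℂ) j) ∈ prodAlg X (Fin (k + 1))
      by_cases h : i' = i
      · subst h
        simp only [hs1]
        have h0 : (fun p : Fin (k + 1) → X => (p i' : Fin (r + 1) → ℂ) j) ∈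
            prodAlg X (Fin (k + 1)) := Algebra.subset_adjoin ⟨i', j, rfl⟩
        exact Subalgebra.smul_mem _ h0 c
      · simp only [hs2 i' h]
        exact Algebra.subset_adjoin ⟨i', j, rfl⟩
    exact fun f hf => this hf
  let g : prodAlg X (Fin (k + 1)) →ₐ[ℂ] prodAlg X (Fin (k + 1)) :=
    ((pullback (s c)).comp (prodAlg X (Fin (k + 1))).val).codRestrict _ fun f => hmem f f.2
  have hg : Function.Injective g := by
    intro f f' h
    ext p
    have := congrFun (congrArg Subtype.val h) (s c⁻¹ p)
    change (f : _ → ℂ) (s c (s c⁻¹ p)) = (f' : _ → ℂ) (s c (s c⁻¹ p)) at this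
    rwa [hs] at this
  have hg' : Function.Injective ((IsScalarTower.toAlgHom ℂ (prodAlg X (Fin (k + 1))) F).comp g) :=
    (IsFractionRing.injective (prodAlg X (Fin (k + 1))) F).comp hg
  let σ : F →ₐ[ℂ] F := IsFractionRing.liftAlgHom hg'
  have hσ : ∀ a, σ (algebraMap _ F a) = algebraMap _ F (g a) := fun a =>
    IsFractionRing.lift_algebraMap hg' a
  refine ⟨σ, fun j => ?_, fun i' h j => ?_⟩
  · have h1 : g (ofRow i (coordFun j)) = c • ofRow i (coordFun j) :=
      Subtype.ext (funext fun p => hs1 j p)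
    rw [coordMatrix, hσ, h1]
    exact map_smul (IsScalarTower.toAlgHom ℂ (prodAlg X (Fin (k + 1))) F) c _
  · have h1 : g (ofRow i' (coordFun j)) = ofRow i' (coordFun j) :=
      Subtype.ext (funext fun p => congrArg (fun x : X => (x : Fin (r + 1) → ℂ) j) (hs2 i' h p))
    rw [coordMatrix, hσ, h1]

end FunctionField

section FunctionField

variable {r k : ℕ} {X : Set (Fin (r + 1) → ℂ)}

theorem linearIndependent_coordFun (hX : Nondeg X) :
    LinearIndependent ℂ (coordFun : Fin (r + 1) → polyAlg X) := by
  refine Fintype.linearIndependent_iff.2 fun c hc => ?_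
  let g : (Fin (r + 1) → ℂ) →ₗ[ℂ] ℂ := ∑ j, c j • LinearMap.proj j
  have hg : g = 0 := by
    refine LinearMap.ext_on hX fun x hx => ?_
    have := congrFun (congrArg Subtype.val hc) ⟨x, hx⟩
    simpa [g, coordFun] using this
  intro j
  have := LinearMap.congr_fun hg (Pi.single j 1)
  simpa [g, Pi.single_apply] using this

/-- Functions on a power of `X` that do not depend on the `i`-th variable. -/
def constAlg {κ T : Type} [DecidableEq κ] (i : κ) : Subalgebra ℂ ((κ → T) → ℂ) where
  carrier := {f | ∀ p x, f (Function.update p i x) = f p}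
  mul_mem' hf hg p x := by rw [Pi.mul_apply, hf, hg, Pi.mul_apply]
  add_mem' hf hg p x := by rw [Pi.add_apply, hf, hg, Pi.add_apply]
  algebraMap_mem' _ _ _ := rfl

variable {F : Type} [Field F] [Algebra ℂ F] [Algebra (prodAlg X (Fin (k + 1))) F]
  [IsScalarTower ℂ (prodAlg X (Fin (k + 1))) F]

theorem exists_mem_constAlg (i : Fin (k + 1)) {x : F}
    (hx : x ∈ Algebra.adjoin ℂ {x | ∃ i', i' ≠ i ∧ ∃ j, coordMatrix k X F i' j = x}) :
    ∃ a : prodAlg X (Fin (k + 1)), algebraMap _ F a = x ∧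
      (a : (Fin (k + 1) → X) → ℂ) ∈ constAlg (T := X) i := by
  have : Algebra.adjoin ℂ {x | ∃ i', i' ≠ i ∧ ∃ j, coordMatrix k X F i' j = x} ≤
      ((constAlg (T := X) i).comap (prodAlg X (Fin (k + 1))).val).map
        (IsScalarTower.toAlgHom ℂ (prodAlg X (Fin (k + 1))) F) := by
    refine Algebra.adjoin_le ?_
    rintro _ ⟨i', hi', j, rfl⟩
    refine ⟨ofRow i' (coordFun j), fun p x => ?_, rfl⟩
    change ((Function.update p i x i' : X) : Fin (r + 1) → ℂ) j = (p i' : Fin (r + 1) → ℂ) j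
    rw [Function.update_of_ne hi']
  obtain ⟨a, ha, ha'⟩ := this hx
  exact ⟨a, ha', ha⟩

variable [IsFractionRing (prodAlg X (Fin (k + 1))) F]

theorem linearIndependent_ofRow {σ : Type} {f : σ → polyAlg X} (hf : LinearIndependent ℂ f)
    (i : Fin (k + 1)) :
    LinearIndependent ((coordMatrix k X F).rowsField i)
      fun s => algebraMap (prodAlg X (Fin (k + 1))) F (ofRow i (f s)) := by
  rw [Matrix.rowsField, ← LinearIndependent.iff_fractionRing
    (Algebra.adjoin ℂ {x | ∃ i', i' ≠ i ∧ ∃ j, coordMatrix k X F i' j = x})]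
  refine linearIndependent_iff'.2 fun s c hc t ht => ?_
  choose a ha ha' using fun t => exists_mem_constAlg (F := F) i (c t).2
  have h1 : ∑ t ∈ s, a t * ofRow i (f t) = 0 := by
    apply IsFractionRing.injective (prodAlg X (Fin (k + 1))) F
    rw [map_zero, map_sum, ← hc]
    refine Finset.sum_congr rfl fun t _ => ?_
    rw [map_mul, ha]
    rfl
  have h2 : a t = 0 := by
    ext p
    have h3 : ∑ t ∈ s, (a t : _ → ℂ) p • f t = 0 := by
      ext x
      have h4 := congrFun (congrArg Subtype.val h1) (Function.update p i x)
      simp only [AddSubmonoidClass.coe_finsetSum, MulMemClass.coe_mul, Finset.sum_apply,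
        Pi.mul_apply, ofRow_apply, Function.update_self, ha' _ p x, ZeroMemClass.coe_zero,
        Pi.zero_apply] at h4
      simpa using h4
    exact linearIndependent_iff'.1 hf s _ h3 t ht
  exact Subtype.ext ((ha t).symm.trans (by rw [h2, map_zero]; rfl))

theorem algebraicIndependent_ofRow {σ : Type} {u : σ → polyAlg X}
    (hu : AlgebraicIndependent ℂ u) (i : Fin (k + 1)) :
    AlgebraicIndependent ((coordMatrix k X F).rowsField i)
      fun s => algebraMap (prodAlg X (Fin (k + 1))) F (ofRow i (u s)) := by
  rw [algebraicIndependent_iff_linearIndependent_monomial] at hu ⊢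
  have key : (fun d : σ →₀ ℕ => aeval (fun s => algebraMap (prodAlg X (Fin (k + 1))) F
      (ofRow i (u s))) (monomial d (1 : (coordMatrix k X F).rowsField i))) =
      fun d => algebraMap (prodAlg X (Fin (k + 1))) F
        (ofRow i (aeval u (monomial d (1 : ℂ)))) := by
    funext d
    rw [aeval_monomial, aeval_monomial, map_one, map_one, one_mul, one_mul, Finsupp.prod,
      Finsupp.prod, map_prod, map_prod]
    simp only [map_pow]
  rw [key]
  exact linearIndependent_ofRow hu i

end FunctionField

end CoordinateMatrix

namespace AlgebraicIndependent

variable {K F : Type} [Field K] [Field F] [Algebra K F]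

theorem eRk_add_encard_le {E : IntermediateField K F} {S : Set F} (hS : S ⊆ E) {σ : Type}
    {y : σ → F} (hy : AlgebraicIndependent E y) :
    (matroid K F).eRk S + ENat.card σ ≤ (matroid K F).eRk (S ∪ Set.range y) := by
  obtain ⟨I, hI⟩ := (matroid K F).exists_isBasis S
  have hI' : AlgebraicIndependent K ((↑) : I → F) := matroid_indep_iff.1 hI.indep
  have hz := AlgebraicIndependent.sumElim_of_tower hI' (by
    rintro _ ⟨x, rfl⟩
    exact ⟨⟨x, hS (hI.subset x.2)⟩, rfl⟩) hy
  have hz' : (matroid K F).Indep (Set.range (Sum.elim y ((↑) : I → F))) :=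
    matroid_indep_iff.2 hz.coe_range
  have h1 := hz'.encard_le_eRk_of_subset (X := S ∪ Set.range y) (by
    rw [Set.Sum.elim_range, Subtype.range_coe, Set.union_comm]
    exact Set.union_subset_union_left _ hI.subset)
  refine le_trans (le_of_eq ?_) h1
  rw [hI.eRk_eq_encard, ← ENat.card_coe_set_eq, ← ENat.card_coe_set_eq,
    ← ENat.card_congr (Equiv.ofInjective _ hz.injective), ENat.card_sum, add_comm]

theorem eRk_image_eq_toENat_trdeg {B : Type} [CommRing B] [Algebra K B] {S : Set B}
    (hS : Algebra.adjoin K S = ⊤) (f : B →ₐ[K] F) (hf : Function.Injective f) :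
    (matroid K F).eRk (f '' S) = Cardinal.toENat (Algebra.trdeg K B) := by
  rw [eRk_eq_toENat_trdeg_adjoin, ← AlgHom.map_adjoin, hS, Algebra.map_top,
    (AlgEquiv.ofInjective f hf).trdeg_eq]

end AlgebraicIndependent

section FunctionField

open Matrix AlgebraicIndependent

variable {r k : ℕ} {X : Set (Fin (r + 1) → ℂ)}
  {F : Type} [Field F] [Algebra ℂ F] [Algebra (prodAlg X (Fin (k + 1))) F]
  [IsScalarTower ℂ (prodAlg X (Fin (k + 1))) F] [IsFractionRing (prodAlg X (Fin (k + 1))) F]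

theorem eRk_row_coordMatrix (i : Fin (k + 1)) :
    (matroid ℂ F).eRk (Set.range (coordMatrix k X F i)) =
      Cardinal.toENat (Algebra.trdeg ℂ (polyAlg X)) := by
  have h := eRk_image_eq_toENat_trdeg (adjoin_coordFun (X := X))
    ((IsScalarTower.toAlgHom ℂ (prodAlg X (Fin (k + 1))) F).comp (ofRow i))
    ((IsFractionRing.injective (prodAlg X (Fin (k + 1))) F).comp (ofRow_injective i))
  rw [← h, ← Set.range_comp]
  rfl

theorem le_eRk_univ_of_trdeg_eq [IsDomain (polyAlg X)] {s : ℕ}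
    (hs : Algebra.trdeg ℂ (polyAlg X) = s) :
    ((s * (k + 1) : ℕ) : ℕ∞) ≤ (matroid ℂ F).eRk Set.univ := by
  classical
  have : FaithfulSMul ℂ (polyAlg X) :=
    (faithfulSMul_iff_algebraMap_injective _ _).2 (algebraMap ℂ (polyAlg X)).injective
  obtain ⟨σ, u, hu⟩ := exists_isTranscendenceBasis' ℂ (polyAlg X)
  have hσ : ENat.card σ = s := by
    rw [ENat.card, hu.cardinalMk_eq_trdeg, hs, map_natCast]
  have key : ∀ t : Finset (Fin (k + 1)), ((s * t.card : ℕ) : ℕ∞) ≤ (matroid ℂ F).eRk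
      (⋃ i ∈ t, Set.range fun s => algebraMap (prodAlg X (Fin (k + 1))) F (ofRow i (u s))) := by
    intro t
    induction t using Finset.induction_on with
    | empty => simp
    | insert i t hi ih =>
      have h := eRk_add_encard_le (K := ℂ) (E := (coordMatrix k X F).rowsField i)
        (S := ⋃ i ∈ t, Set.range fun s => algebraMap (prodAlg X (Fin (k + 1))) F (ofRow i (u s)))
        ?_ (algebraicIndependent_ofRow hu.1 i)
      · rw [Finset.set_biUnion_insert, Set.union_comm, Finset.card_insert_of_notMem hi, mul_add,
          mul_one, Nat.cast_add]
        rw [hσ] at h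
        exact (add_le_add_left ih _).trans h
      · simp only [Set.iUnion_subset_iff]
        rintro i' hi' _ ⟨s, rfl⟩
        have : (⊤ : Subalgebra ℂ (polyAlg X)) ≤
            ((coordMatrix k X F).rowsField i).toSubalgebra.comap
              ((IsScalarTower.toAlgHom ℂ (prodAlg X (Fin (k + 1))) F).comp (ofRow i')) := by
          rw [← adjoin_coordFun]
          refine Algebra.adjoin_le ?_
          rintro _ ⟨j, rfl⟩
          exact IntermediateField.subset_adjoin _ _
            ⟨i', fun h => hi (h ▸ hi'), j, rfl⟩
        exact this (Algebra.mem_top (x := u s))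
  simpa using (key Finset.univ).trans ((matroid ℂ F).eRk_mono (Set.subset_univ _))

theorem isGenericMatrix_coordMatrix [IsDomain (polyAlg X)] (hX : IsCone X) (hnd : Nondeg X)
    {n : ℕ} (hn : Algebra.trdeg ℂ (polyAlg X) = (n + 1 : ℕ)) :
    IsGenericMatrix n (coordMatrix k X F) where
  adjoin_entries := adjoin_entries_coordMatrix F
  exists_scale i _ hc := exists_scale_coordMatrix F hX i hc
  linearIndependent i := linearIndependent_ofRow (linearIndependent_coordFun hnd) i
  eRk_row_le i := by rw [eRk_row_coordMatrix, hn, map_natCast]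
  le_eRk := le_eRk_univ_of_trdeg_eq hn

end FunctionField

section Plucker

open Matrix AlgebraicIndependent

theorem AlternatingMap.factorial_smul_eq_sum_det {ι κ R : Type*} [CommRing R] [Fintype ι]
    [DecidableEq ι] [Fintype κ] [DecidableEq κ] (A : (ι → R) [⋀^κ]→ₗ[R] R) (p : κ → ι → R) :
    (Fintype.card κ).factorial • A p =
      ∑ v : κ → ι, A (fun i => Pi.single (v i) 1) * det (of fun i j => p i (v j)) := by
  have expand : ∀ q : κ → ι → R,
      A q = ∑ v : κ → ι, (∏ i, q i (v i)) * A (fun i => Pi.single (v i) 1) := by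
    intro q
    have h := A.toMultilinearMap.map_sum fun i j => q i j • (Pi.single j 1 : ι → R)
    simp only [← pi_eq_sum_univ' (R := R) (q _), MultilinearMap.map_smul_univ] at h
    exact h
  have h1 : ∀ σ : Equiv.Perm κ, A p = ∑ v : κ → ι, A (fun i => Pi.single (v i) 1) *
      ((Equiv.Perm.sign σ : ℤ) * ∏ i, p (σ i) (v i)) := by
    intro σ
    have h2 := A.map_perm p σ
    rw [expand (p ∘ σ)] at h2
    have h3 : A p = ((Equiv.Perm.sign σ : ℤ) : R) * (Equiv.Perm.sign σ • A p) := by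
      rw [Units.smul_def, zsmul_eq_mul, ← mul_assoc, ← Int.cast_mul, ← Units.val_mul,
        Int.units_mul_self]
      simp
    rw [h3, ← h2, Finset.mul_sum]
    exact Finset.sum_congr rfl fun v _ => by simp only [Function.comp_apply]; ring
  rw [← Fintype.card_perm, ← Finset.card_univ, ← Finset.sum_const,
    Finset.sum_congr rfl fun σ _ => h1 σ, Finset.sum_comm]
  refine Finset.sum_congr rfl fun v _ => ?_
  rw [← Finset.mul_sum, det_apply']
  rfl

variable {r k : ℕ} {X : Set (Fin (r + 1) → ℂ)}

variable (X k) in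
/-- Plücker points of tuples of points of `X`. -/
def pluckerMap (p : Fin (k + 1) → X) : ExteriorAlgebra ℂ (Fin (r + 1) → ℂ) :=
  ExteriorAlgebra.ιMulti ℂ (k + 1) fun i => (p i : Fin (r + 1) → ℂ)

theorem gkConePre_eq_range : GkConePre X k = Set.range (pluckerMap k X) := by
  ext w
  constructor
  · rintro ⟨p, hp, rfl⟩
    exact ⟨fun i => ⟨p i, hp i⟩, rfl⟩
  · rintro ⟨p, rfl⟩
    exact ⟨fun i => p i, fun i => (p i).2, rfl⟩

variable (X) in
/-- The minors of the coordinate functions on a power of `X`. -/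
def minorFun (v : Fin (k + 1) → Fin (r + 1)) : prodAlg X (Fin (k + 1)) :=
  det (of fun i j => ofRow i (coordFun (v j)))

theorem minorFun_apply (v : Fin (k + 1) → Fin (r + 1)) (p : Fin (k + 1) → X) :
    (minorFun X v : (Fin (k + 1) → X) → ℂ) p =
      det (of fun i j => (p i : Fin (r + 1) → ℂ) (v j)) := by
  let e : prodAlg X (Fin (k + 1)) →+* ℂ :=
    (Pi.evalRingHom (fun _ => ℂ) p).comp (prodAlg X (Fin (k + 1))).val.toRingHom
  exact e.map_det _

theorem coordAlg_pluckerMap : coordAlg (pluckerMap k X) =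
    Algebra.adjoin ℂ (Set.range fun v : Fin (k + 1) → Fin (r + 1) =>
      (minorFun X v : (Fin (k + 1) → X) → ℂ)) := by
  rw [coordAlg, PolyFun, AlgHom.map_adjoin]
  apply le_antisymm
  · refine Algebra.adjoin_le ?_
    rintro _ ⟨g, hg, rfl⟩
    let A := (IsLinearMap.mk' g hg).compAlternatingMap
      (ExteriorAlgebra.ιMulti ℂ (M := Fin (r + 1) → ℂ) (k + 1))
    have : pullback (pluckerMap k X) g = ((Fintype.card (Fin (k + 1))).factorial : ℂ)⁻¹ •
        ∑ v, A (fun i => Pi.single (v i) 1) • (minorFun X v : (Fin (k + 1) → X) → ℂ) := by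
      funext p
      have h := A.factorial_smul_eq_sum_det fun i => (p i : Fin (r + 1) → ℂ)
      rw [Pi.smul_apply, Finset.sum_apply, eq_inv_smul_iff₀
        (Nat.cast_ne_zero.2 (Nat.factorial_ne_zero _)), Nat.cast_smul_eq_nsmul]
      refine h.trans (Finset.sum_congr rfl fun v _ => ?_)
      rw [Pi.smul_apply, minorFun_apply, smul_eq_mul]
    rw [SetLike.mem_coe, this]
    exact Subalgebra.smul_mem _ (sum_mem fun v _ => Subalgebra.smul_mem _
      (Algebra.subset_adjoin (Set.mem_range_self v)) _) _
  · refine Algebra.adjoin_mono ?_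
    rintro _ ⟨v, rfl⟩
    let f : (Fin (r + 1) → ℂ) [⋀^Fin (k + 1)]→ₗ[ℂ] ℂ :=
      (detRowAlternating (n := Fin (k + 1)) (R := ℂ)).compLinearMap (LinearMap.funLeft ℂ ℂ v)
    refine ⟨_, (ExteriorAlgebra.liftAlternating (R := ℂ) (Pi.single (k + 1) f)).isLinear, ?_⟩
    funext p
    rw [pullback_apply, pluckerMap, ExteriorAlgebra.liftAlternating_apply_ιMulti, Pi.single_eq_same]
    exact (minorFun_apply v p).symm

end Plucker

instance ExteriorAlgebra.instModuleFinite {K M : Type*} [Field K] [AddCommGroup M] [Module K M]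
    [Module.Finite K M] : Module.Finite K (ExteriorAlgebra K M) := by
  have htop := (DirectSum.Decomposition.isInternal
    fun n : ℕ => ⋀[K]^n M).submodule_iSup_eq_top
  rw [Module.finite_def, ← htop]
  have : ⨆ n, ⋀[K]^n M = ⨆ n ∈ Finset.range (Module.finrank K M + 1), ⋀[K]^n M := by
    refine le_antisymm (iSup_le fun n => ?_) (iSup₂_le fun n _ => le_iSup (fun n => ⋀[K]^n M) n)
    by_cases hn : n ∈ Finset.range (Module.finrank K M + 1)
    · exact le_iSup₂ (f := fun n _ => ⋀[K]^n M) n hn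
    · have h0 : ⋀[K]^n M = ⊥ := by
        rw [← Submodule.finrank_eq_zero, exteriorPower.finrank_eq, Nat.choose_eq_zero_of_lt]
        simpa [Nat.lt_succ_iff] using hn
      rw [h0]
      exact bot_le
  rw [this]
  exact Submodule.fg_biSup _ _ fun n _ => Module.Finite.iff_fg.1 inferInstance

theorem Subalgebra.trdeg_map_of_injective {R A B : Type} [CommRing R] [CommRing A] [CommRing B]
    [Algebra R A] [Algebra R B] (S : Subalgebra R A) (f : A →ₐ[R] B)
    (hf : Function.Injective f) : Algebra.trdeg R (S.map f) = Algebra.trdeg R S :=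
  (Subalgebra.equivMapOfInjective S f hf).trdeg_eq.symm

theorem isAlgSet_singleton_zero (ι : Type*) : IsAlgSet ({0} : Set (ι → ℂ)) := by
  refine ⟨Set.range fun j x => x j, ?_, ?_⟩
  · rintro _ ⟨j, rfl⟩
    exact Algebra.subset_adjoin (LinearMap.proj j : (ι → ℂ) →ₗ[ℂ] ℂ).isLinear
  · ext x
    simp only [Set.mem_singleton_iff, funext_iff, Set.mem_ofPred_eq, Set.forall_mem_range,
      Pi.zero_apply]

theorem one_le_adim_of_isProjVar {ι : Type*} {X : Set (ι → ℂ)} (hX : IsProjVar X) :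
    1 ≤ adim X := by
  obtain ⟨-, hc, hirr, hne⟩ := hX
  have h0 : ({0} : Set (ι → ℂ)) ⊆ X := Set.singleton_subset_iff.2 hc.1
  refine le_sSup ⟨1, rfl, ![{0}, X], ?_, ?_⟩
  · rw [Fin.strictMono_iff_lt_succ]
    intro i
    rw [Subsingleton.elim i 0]
    exact h0.ssubset_of_ne hne.symm
  · rw [Fin.forall_fin_two]
    refine ⟨⟨⟨Set.singleton_nonempty 0, isAlgSet_singleton_zero ι, fun Y Z _ _ h => ?_⟩, h0⟩,
      hirr, subset_rfl⟩
    exact (h rfl).imp Set.singleton_subset_iff.2 Set.singleton_subset_iff.2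

section Plucker

open Matrix AlgebraicIndependent

variable {r k : ℕ} {X : Set (Fin (r + 1) → ℂ)}

theorem trdeg_polyAlg_of_isProjVar (hX : IsProjVar X) {n : ℕ} (hn : pdim X = n) :
    Algebra.trdeg ℂ (polyAlg X) = (n + 1 : ℕ) := by
  have := isDomain_polyAlg hX.2.2.1
  rw [← coordAlg_subtypeVal] at this ⊢
  obtain ⟨s, hs, hs'⟩ := adim_zcl_range (Subtype.val : X → Fin (r + 1) → ℂ)
  rw [Subtype.range_coe, (zcl_subset hX.1 subset_rfl).antisymm (subset_zcl X)] at hs'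
  have h1 := one_le_adim_of_isProjVar hX
  rw [hs]
  rw [pdim, hs'] at hn
  rw [hs'] at h1
  norm_cast at *
  omega

theorem coordAlg_pluckerMap_eq_map : coordAlg (pluckerMap k X) =
    (Algebra.adjoin ℂ (Set.range (minorFun (k := k) X))).map (prodAlg X (Fin (k + 1))).val := by
  rw [coordAlg_pluckerMap, AlgHom.map_adjoin, ← Set.range_comp]
  rfl

theorem isDomain_coordAlg_pluckerMap (hX : IsIrrAlg X) : IsDomain (coordAlg (pluckerMap k X)) := by
  have := hX.1.to_subtype
  have hle : coordAlg (pluckerMap k X) ≤ prodAlg X (Fin (k + 1)) := by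
    rw [coordAlg_pluckerMap_eq_map]
    rintro _ ⟨f, -, rfl⟩
    exact f.2
  exact isDomain_of_exists_mul_ne_zero _ fun _ hf _ hg =>
    exists_mul_ne_zero_of_mem_prodAlg hX (hle hf) (hle hg)

theorem toENat_trdeg_coordAlg_pluckerMap {F : Type} [Field F] [Algebra ℂ F]
    [Algebra (prodAlg X (Fin (k + 1))) F] [IsScalarTower ℂ (prodAlg X (Fin (k + 1))) F]
    [IsFractionRing (prodAlg X (Fin (k + 1))) F] :
    Cardinal.toENat (Algebra.trdeg ℂ (coordAlg (pluckerMap k X))) =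
      (matroid ℂ F).eRk (coordMatrix k X F).maximalMinors := by
  let f := IsScalarTower.toAlgHom ℂ (prodAlg X (Fin (k + 1))) F
  have hf : Function.Injective f := IsFractionRing.injective (prodAlg X (Fin (k + 1))) F
  have h : Algebra.adjoin ℂ (coordMatrix k X F).maximalMinors =
      (Algebra.adjoin ℂ (Set.range (minorFun (k := k) X))).map f := by
    rw [AlgHom.map_adjoin, ← Set.range_comp]
    exact congrArg (fun g => Algebra.adjoin ℂ (Set.range g)) (funext fun v =>
      (f.toRingHom.map_det (of fun i j => ofRow i (coordFun (v j)))).symm)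
  rw [eRk_eq_toENat_trdeg_adjoin, h, coordAlg_pluckerMap_eq_map,
    Subalgebra.trdeg_map_of_injective _ _ Subtype.val_injective,
    Subalgebra.trdeg_map_of_injective _ _ hf]

theorem trdeg_coordAlg_pluckerMap (hk : k ≤ r) (hX : IsProjVar X) (hnd : Nondeg X) {n : ℕ}
    (hn : pdim X = n) : Cardinal.toENat (Algebra.trdeg ℂ (coordAlg (pluckerMap k X))) =
      (min (n * (k + 1)) ((r - k) * (k + 1)) + 1 : ℕ) := by
  have := isDomain_polyAlg hX.2.2.1
  have := isDomain_prodAlg (κ := Fin (k + 1)) hX.2.2.1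
  have hM := isGenericMatrix_coordMatrix (k := k)
    (F := FractionRing (prodAlg X (Fin (k + 1)))) hX.2.1 hnd (trdeg_polyAlg_of_isProjVar hX hn)
  rw [toENat_trdeg_coordAlg_pluckerMap (F := FractionRing (prodAlg X (Fin (k + 1)))),
    hM.eRk_maximalMinors hk]

end Plucker

/-- `G_k(X)` always has the expected dimension `min{n(k+1), (r-k)(k+1)}`. -/
theorem dim_Gk_eq_expected (r n k : ℕ) (hk : k ≤ r)
    (X : Set (Fin (r + 1) → ℂ)) (hX : IsProjVar X) (hnd : Nondeg X)
    (hdim : pdim X = (n : ℕ∞)) :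
    pdim (GkCone X k) = ((min (n * (k + 1)) ((r - k) * (k + 1)) : ℕ) : ℕ∞) := by
  have := isDomain_coordAlg_pluckerMap (k := k) hX.2.2.1
  obtain ⟨s, hs, hs'⟩ := adim_zcl_range (pluckerMap k X)
  have h := trdeg_coordAlg_pluckerMap hk hX hnd hdim
  rw [hs, map_natCast] at h
  rw [pdim, GkCone, gkConePre_eq_range, hs', h, Nat.cast_add, Nat.cast_one]
  exact (ENat.addLECancellable_of_ne_top ENat.one_ne_top).add_tsub_cancel_right
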